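/- arXiv:2210.07326 — 7 statements merged into one kernel-verified Lean document; each statement's English description precedes it below -/
import Mathlib

section
/- Let Ω ⊆ ℂ be an LMI region determined by a real symmetric s×s matrix B and a real s×s matrix C, i.e. Ω = {z ∈ ℂ : B + zC + conj(z)Cᵀ is negative definite}. A real n×n matrix A is Ω-stable if and only if there exists a real symmetric n×n matrix X that is positive definite and such that the real symmetric ns×ns matrix B ⊗ X + C ⊗ (AX) + Cᵀ ⊗ (AX)ᵀ is negative definite (⊗ is the Kronecker product). -/
open Matrix Kronecker
open scoped ComplexOrder

namespace Matrix

/-- Positive definiteness is an open condition along a continuous family of Hermitian matrices. -/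
theorem PosDef.eventually_posDef {m : Type*} [Fintype m] {M : ℝ → Matrix m m ℂ}
    (hc : Continuous M) (hH : ∀ t, (M t).IsHermitian) {t₀ : ℝ} (h₀ : (M t₀).PosDef) :
    ∀ᶠ t in nhds t₀, (M t).PosDef := by
  have hq : Continuous fun p : ℝ × (m → ℂ) ↦ RCLike.re (star p.2 ⬝ᵥ (M p.1 *ᵥ p.2)) := by
    fun_prop
  have hs : ∀ᶠ t in nhds t₀, ∀ x ∈ Metric.sphere (0 : m → ℂ) 1,
      0 < RCLike.re (star x ⬝ᵥ (M t *ᵥ x)) := by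
    refine (isCompact_sphere _ _).eventually_forall_of_forall_eventually fun x hx ↦ ?_
    refine hq.continuousAt.eventually (lt_mem_nhds (h₀.re_dotProduct_pos ?_))
    rintro rfl
    simp at hx
  filter_upwards [hs] with t ht
  refine .of_dotProduct_mulVec_pos (hH t) fun x hx ↦ ?_
  have hn : 0 < ‖x‖ := norm_pos_iff.mpr hx
  have hx' := ht ((‖x‖⁻¹ : ℝ) • x) (by simp [norm_smul, hn.ne'])
  refine RCLike.pos_iff.mpr ⟨?_, (hH t).im_star_dotProduct_mulVec_self x⟩
  have he : RCLike.re (star ((‖x‖⁻¹ : ℝ) • x) ⬝ᵥ (M t *ᵥ ((‖x‖⁻¹ : ℝ) • x)))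
      = ‖x‖⁻¹ * (‖x‖⁻¹ * RCLike.re (star x ⬝ᵥ (M t *ᵥ x))) := by
    simp [mulVec_smul, star_smul]
  rw [he] at hx'
  have hi : 0 < ‖x‖⁻¹ := inv_pos.mpr hn
  exact pos_of_mul_pos_right (pos_of_mul_pos_right hx' hi.le) hi.le

theorem PosDef.blockDiagonal {m o : Type*} [Fintype m] [Fintype o] [DecidableEq o]
    {M : o → Matrix m m ℂ} (h : ∀ k, (M k).PosDef) : (blockDiagonal M).PosDef := by
  refine .of_dotProduct_mulVec_pos ?_ fun x hx ↦ ?_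
  · rw [IsHermitian, blockDiagonal_conjTranspose]
    exact congrArg _ (funext fun k ↦ (h k).isHermitian)
  have he : star x ⬝ᵥ (Matrix.blockDiagonal M *ᵥ x)
      = ∑ k, star (fun i ↦ x (i, k)) ⬝ᵥ (M k *ᵥ fun i ↦ x (i, k)) := by
    simp only [dotProduct, mulVec, Fintype.sum_prod_type, blockDiagonal_apply, ite_mul, zero_mul,
      Finset.sum_ite_eq, Finset.mem_univ, if_true, Pi.star_apply]
    exact Finset.sum_comm
  rw [he]
  obtain ⟨⟨i, k⟩, hik⟩ := Function.ne_iff.mp hx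
  exact Finset.sum_pos' (fun k _ ↦ (h k).posSemidef.dotProduct_mulVec_nonneg _)
    ⟨k, Finset.mem_univ k, (h k).dotProduct_mulVec_pos fun h0 ↦ hik (congrFun h0 i)⟩

theorem PosDef.map_re {m : Type*} [Fintype m] {M : Matrix m m ℂ} (h : M.PosDef) :
    (M.map Complex.re).PosDef := by
  refine .of_dotProduct_mulVec_pos ?_ fun x hx ↦ ?_
  · ext i j
    simpa using congrArg Complex.re (h.isHermitian.apply i j)
  · have hx' : (fun i ↦ (x i : ℂ)) ≠ 0 := fun h0 ↦
      hx (funext fun i ↦ Complex.ofReal_eq_zero.mp (congrFun h0 i))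
    have := h.re_dotProduct_pos hx'
    simpa [dotProduct, mulVec] using this

open scoped MatrixOrder in
theorem PosDef.map_ofReal {m : Type*} [Fintype m] {M : Matrix m m ℝ} (h : M.PosDef) :
    (M.map Complex.ofReal).PosDef := by
  classical
  have hu : IsUnit (M.map Complex.ofReal) := h.isUnit.map Complex.ofRealHom.mapMatrix
  obtain ⟨a, rfl⟩ := CStarAlgebra.nonneg_iff_eq_star_mul_self.mp h.posSemidef.nonneg
  have he : (star a * a).map Complex.ofReal = (a.map Complex.ofReal)ᴴ * a.map Complex.ofReal := by
    ext i j
    simp [mul_apply]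
  rw [he] at hu ⊢
  exact (posSemidef_conjTranspose_mul_self _).posDef_iff_isUnit.mpr hu

/-- Every complex square matrix is similar to an upper triangular one. -/
theorem exists_upperTriangular_conj : ∀ {n : ℕ} (A : Matrix (Fin n) (Fin n) ℂ),
    ∃ P S : Matrix (Fin n) (Fin n) ℂ, P * S = 1 ∧ (S * A * P).BlockTriangular id
  | 0, A => ⟨1, 1, Subsingleton.elim _ _, fun i ↦ i.elim0⟩
  | n + 1, A => by
    obtain ⟨z, hz⟩ := IsAlgClosed.exists_root A.charpoly (by
      rw [charpoly_degree_eq_dim, Fintype.card_fin]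
      exact_mod_cast n.succ_ne_zero)
    rw [Polynomial.IsRoot, eval_charpoly] at hz
    obtain ⟨v, hv, hvz⟩ := exists_mulVec_eq_zero_iff.mpr hz
    have hv' : A *ᵥ v = z • v := by
      rw [sub_mulVec, sub_eq_zero] at hvz
      rw [← hvz]
      ext i
      simp [mulVec_diagonal]
    obtain ⟨e, he⟩ := SeparatingDual.exists_continuousLinearEquiv_apply_eq (R := ℂ)
      (x := Pi.single (0 : Fin (n + 1)) (1 : ℂ)) (y := v) (by simp) hv
    obtain ⟨e, he⟩ : ∃ e : (Fin (n + 1) → ℂ) ≃ₗ[ℂ] (Fin (n + 1) → ℂ), e (Pi.single 0 1) = v :=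
      ⟨e.toLinearEquiv, he⟩
    have hQR : LinearMap.toMatrix' e.toLinearMap *
        LinearMap.toMatrix' e.symm.toLinearMap = 1 := by
      rw [← LinearMap.toMatrix'_comp, ← LinearMap.toMatrix'_id]
      congr 1
      ext x
      simp
    have hQ0 : LinearMap.toMatrix' e.toLinearMap *ᵥ Pi.single 0 1 = v := by
      rw [LinearMap.toMatrix'_mulVec]
      exact he
    generalize LinearMap.toMatrix' e.toLinearMap = Q at hQR hQ0
    generalize LinearMap.toMatrix' e.symm.toLinearMap = R at hQR
    have hRQ : R * Q = 1 := mul_eq_one_comm.mp hQR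
    have hcol : (R * A * Q) *ᵥ Pi.single 0 1 = z • Pi.single 0 1 := by
      rw [← mulVec_mulVec, hQ0, ← mulVec_mulVec, hv', mulVec_smul, ← hQ0, mulVec_mulVec, hRQ,
        one_mulVec]
    have hcol' : ∀ i : Fin n, (R * A * Q) i.succ 0 = 0 := fun i ↦ by
      simpa using congrFun hcol i.succ
    obtain ⟨P, S, hPS, hT⟩ := exists_upperTriangular_conj ((R * A * Q).submatrix Fin.succ Fin.succ)
    let P' : Matrix (Fin (n + 1)) (Fin (n + 1)) ℂ :=
      of (Fin.cons (Fin.cons 1 0) fun i ↦ Fin.cons 0 (P i))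
    let S' : Matrix (Fin (n + 1)) (Fin (n + 1)) ℂ :=
      of (Fin.cons (Fin.cons 1 0) fun i ↦ Fin.cons 0 (S i))
    have hPS' : P' * S' = 1 := by
      ext i j
      have := fun i j ↦ congrFun (congrFun hPS i) j
      simp only [mul_apply] at this
      refine Fin.cases ?_ (fun i ↦ ?_) i <;> refine Fin.cases ?_ (fun j ↦ ?_) j <;>
        simp [P', S', mul_apply, Fin.sum_univ_succ, this, one_apply, (Fin.succ_ne_zero _).symm]
    refine ⟨Q * P', S' * R, ?_, ?_⟩
    · rw [Matrix.mul_assoc, ← Matrix.mul_assoc P', hPS', Matrix.one_mul, hQR]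
    · have hre : S' * R * A * (Q * P') = S' * (R * A * Q) * P' := by
        simp only [Matrix.mul_assoc]
      rw [hre]
      generalize R * A * Q = N at *
      intro i j hij
      induction i using Fin.cases with
      | zero => exact absurd hij (Fin.not_lt_zero j)
      | succ i =>
        induction j using Fin.cases with
        | zero => simp [P', S', mul_apply, Fin.sum_univ_succ, hcol']
        | succ j =>
          have := hT (i := i) (j := j) (by simpa using hij)
          simpa [P', S', mul_apply, Fin.sum_univ_succ] using this

/-- A complex matrix is similar to every member of a continuous family `F t`, `t ≠ 0`, whose value
at `0` is a diagonal matrix of eigenvalues. -/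
theorem exists_continuous_similar_diagonal {n : ℕ} (A : Matrix (Fin n) (Fin n) ℂ) :
    ∃ (F : ℝ → Matrix (Fin n) (Fin n) ℂ) (d : Fin n → ℂ), Continuous F ∧ F 0 = diagonal d ∧
      (∀ i, A.charpoly.IsRoot (d i)) ∧
      ∀ t ≠ 0, ∃ G : Matrix (Fin n) (Fin n) ℂ, IsUnit G ∧ A * G = G * F t := by
  obtain ⟨P, S, hPS, hT⟩ := exists_upperTriangular_conj A
  have hSP : S * P = 1 := mul_eq_one_comm.mp hPS
  have hchar : A.charpoly = (S * A * P).charpoly := by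
    rw [charpoly_mul_comm, ← Matrix.mul_assoc, hPS, Matrix.one_mul]
  have hAP : A * P = P * (S * A * P) := by
    simp only [← Matrix.mul_assoc, hPS, Matrix.one_mul]
  generalize S * A * P = T at *
  refine ⟨fun t ↦ of fun i j ↦ (t : ℂ) ^ (j.val - i.val) * T i j, fun i ↦ T i i, ?_, ?_, ?_, ?_⟩
  · refine continuous_matrix fun i j ↦ ?_
    simp only [of_apply]
    fun_prop
  · ext i j
    rcases lt_trichotomy i j with h | h | h
    · have : j.val - i.val ≠ 0 := by have := Fin.lt_def.mp h; omega
      simp [diagonal_apply_ne _ h.ne, this]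
    · simp [h]
    · simp [diagonal_apply_ne _ h.ne', hT h]
  · intro i
    rw [hchar, charpoly_of_isUpperTriangular T hT, Polynomial.IsRoot, Polynomial.eval_prod]
    exact Finset.prod_eq_zero (Finset.mem_univ i) (by simp)
  · intro t ht
    refine ⟨P * diagonal fun i ↦ (t : ℂ) ^ i.val, ?_, ?_⟩
    · refine IsUnit.mul (IsUnit.of_mul_eq_one S hPS) ?_
      rw [isUnit_diagonal, Pi.isUnit_iff]
      simp [ht]
    · rw [← Matrix.mul_assoc, hAP, Matrix.mul_assoc, Matrix.mul_assoc]
      congr 1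
      ext i j
      rw [mul_diagonal, diagonal_mul]
      change T i j * (t : ℂ) ^ j.val = (t : ℂ) ^ i.val * ((t : ℂ) ^ (j.val - i.val) * T i j)
      rcases lt_or_ge j i with h | h
      · simp [hT h]
      · rw [← mul_assoc, ← pow_add, Nat.add_sub_cancel' h, mul_comm]


/-- A solution `X` of the linear matrix inequality forces every eigenvalue of `A` (with left
eigenvector `v`) into the LMI region. -/
theorem PosDef.lmi_of_vecMul_eq_smul {s n : ℕ} {B C : Matrix (Fin s) (Fin s) ℂ}
    {A X : Matrix (Fin n) (Fin n) ℂ} (hX : X.PosDef)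
    (hM : (-(B ⊗ₖ X + C ⊗ₖ (A * X) + Cᵀ ⊗ₖ (A * X)ᴴ)).PosDef)
    {v : Fin n → ℂ} (hv : v ≠ 0) {z : ℂ} (hvz : v ᵥ* A = z • v) :
    (-(B + z • C + starRingEnd ℂ z • Cᵀ)).PosDef := by
  set V : Matrix Unit (Fin n) ℂ := replicateRow Unit v with hV
  have hVA : V * A = z • V := by
    rw [hV, ← replicateRow_vecMul, hvz]
    rfl
  have hVinj : Function.Injective Vᴴ.mulVec := by
    obtain ⟨k, hk⟩ := Function.ne_iff.mp hv
    intro x y hxy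
    ext ⟨⟩
    have := congrFun hxy k
    simpa [V, mulVec, dotProduct, show v k ≠ 0 from hk] using this
  have hWinj : Function.Injective ((1 : Matrix (Fin s) (Fin s) ℂ) ⊗ₖ Vᴴ).mulVec := by
    obtain ⟨k, hk⟩ := Function.ne_iff.mp hv
    intro x y hxy
    ext ⟨i, ⟨⟩⟩
    have := congrFun hxy (i, k)
    simpa [V, mulVec, dotProduct, Fintype.sum_prod_type, one_apply,
      show v k ≠ 0 from hk] using this
  have hY : (V * X * Vᴴ).PosDef := by
    simpa using hX.conjTranspose_mul_mul_same hVinj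
  have hAX : V * (A * X) * Vᴴ = z • (V * X * Vᴴ) := by
    rw [← Matrix.mul_assoc, hVA, smul_mul, smul_mul]
  have hAXH : V * (A * X)ᴴ * Vᴴ = starRingEnd ℂ z • (V * X * Vᴴ) := by
    have := congrArg (fun M : Matrix Unit Unit ℂ ↦ Mᴴ) hAX
    rwa [conjTranspose_mul, conjTranspose_mul, conjTranspose_smul, hY.isHermitian.eq,
      conjTranspose_conjTranspose, ← Matrix.mul_assoc] at this
  have hW := hM.conjTranspose_mul_mul_same hWinj
  have he : ((1 : Matrix (Fin s) (Fin s) ℂ) ⊗ₖ Vᴴ)ᴴ *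
      (-(B ⊗ₖ X + C ⊗ₖ (A * X) + Cᵀ ⊗ₖ (A * X)ᴴ)) * ((1 : Matrix (Fin s) (Fin s) ℂ) ⊗ₖ Vᴴ)
      = (-(B + z • C + starRingEnd ℂ z • Cᵀ)) ⊗ₖ (V * X * Vᴴ) := by
    rw [conjTranspose_kronecker, conjTranspose_conjTranspose, conjTranspose_one, Matrix.mul_neg,
      Matrix.neg_mul]
    simp only [Matrix.mul_add, Matrix.add_mul, ← mul_kronecker_mul, Matrix.one_mul, Matrix.mul_one,
      hAX, hAXH]
    ext i j
    simp only [neg_apply, add_apply, kroneckerMap_apply, smul_apply, smul_eq_mul]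
    ring
  rw [he] at hW
  have hc : 0 < (V * X * Vᴴ) () () := hY.diag_pos
  have hS := (hW.submatrix (e := fun i : Fin s ↦ (i, ())) fun i j h ↦ congrArg Prod.fst h).smul
    (inv_pos.mpr hc)
  convert hS using 1
  ext i j
  simp only [smul_apply, submatrix_apply, kroneckerMap_apply, smul_eq_mul]
  field_simp

/-- If all eigenvalues of `A` lie in the LMI region, the linear matrix inequality has a complex
positive definite solution. -/
theorem exists_posDef_lmi_of_roots {s n : ℕ} {B C : Matrix (Fin s) (Fin s) ℂ}
    (hB : B.IsHermitian) (hC : Cᴴ = Cᵀ) {A : Matrix (Fin n) (Fin n) ℂ}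
    (h : ∀ z, A.charpoly.IsRoot z → (-(B + z • C + starRingEnd ℂ z • Cᵀ)).PosDef) :
    ∃ X : Matrix (Fin n) (Fin n) ℂ, X.PosDef ∧
      (-(B ⊗ₖ X + C ⊗ₖ (A * X) + Cᵀ ⊗ₖ (A * X)ᴴ)).PosDef := by
  obtain ⟨F, d, hF, hF0, hd, hG⟩ := exists_continuous_similar_diagonal A
  have hev : ∀ᶠ t in nhds (0 : ℝ),
      (-(B ⊗ₖ (1 : Matrix (Fin n) (Fin n) ℂ) + C ⊗ₖ F t + Cᵀ ⊗ₖ (F t)ᴴ)).PosDef := by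
    refine PosDef.eventually_posDef ?_ (fun t ↦ ?_) ?_
    · refine continuous_matrix fun i j ↦ ?_
      simp only [neg_apply, add_apply, kroneckerMap_apply, conjTranspose_apply]
      fun_prop
    · have hCt : (Cᵀ)ᴴ = C := by rw [← hC, conjTranspose_conjTranspose]
      rw [IsHermitian, conjTranspose_neg, conjTranspose_add, conjTranspose_add,
        conjTranspose_kronecker, conjTranspose_kronecker, conjTranspose_kronecker, hB.eq, hC, hCt,
        conjTranspose_one, conjTranspose_conjTranspose, add_right_comm]
    · convert PosDef.blockDiagonal fun k ↦ h (d k) (hd k) using 1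
      ext ⟨i, k⟩ ⟨j, l⟩
      rw [hF0]
      by_cases hkl : k = l
      · subst hkl
        simp [blockDiagonal_apply, mul_comm]
      · simp [blockDiagonal_apply, hkl]
  obtain ⟨t, ht, ht0⟩ := ((hev.filter_mono nhdsWithin_le_nhds).and
    (self_mem_nhdsWithin (s := {(0 : ℝ)}ᶜ))).exists
  obtain ⟨G, hGu, hAG⟩ := hG t ht0
  refine ⟨G * Gᴴ, .mul_conjTranspose_self _ (vecMul_injective_of_isUnit hGu), ?_⟩
  have hW : IsUnit ((1 : Matrix (Fin s) (Fin s) ℂ) ⊗ₖ G) := isUnit_one.kronecker hGu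
  convert ht.mul_mul_conjTranspose_same (vecMul_injective_of_isUnit hW) using 1
  have h1 : A * (G * Gᴴ) = G * F t * Gᴴ := by rw [← Matrix.mul_assoc, hAG]
  have h2 : (G * F t * Gᴴ)ᴴ = G * (F t)ᴴ * Gᴴ := by
    simp only [conjTranspose_mul, conjTranspose_conjTranspose, Matrix.mul_assoc]
  rw [conjTranspose_kronecker, conjTranspose_one, Matrix.mul_neg, Matrix.neg_mul, h1, h2]
  simp only [Matrix.mul_add, Matrix.add_mul, ← mul_kronecker_mul, Matrix.one_mul, Matrix.mul_one]

end Matrix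

/-- DH characterization of Ω-stability for a generic LMI region (Theorem 2.2 of Chilali–Gahinet):
`A` is Ω-stable for the LMI region Ω determined by `B` (symmetric) and `C` iff there is a
symmetric positive definite `X` with `B ⊗ X + C ⊗ (AX) + Cᵀ ⊗ (AX)ᵀ ≺ 0`. -/
theorem lmi_region_stability_iff {s n : ℕ}
    (B C : Matrix (Fin s) (Fin s) ℝ) (hB : B.IsSymm)
    (A : Matrix (Fin n) (Fin n) ℝ) :
    (∀ z : ℂ, ((A.map Complex.ofReal).charpoly).IsRoot z →
      (-(B.map Complex.ofReal + z • C.map Complex.ofReal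
          + (starRingEnd ℂ z) • (C.map Complex.ofReal)ᵀ)).PosDef)
    ↔ ∃ X : Matrix (Fin n) (Fin n) ℝ, X.IsSymm ∧ X.PosDef ∧
        (-(B ⊗ₖ X + C ⊗ₖ (A * X) + Cᵀ ⊗ₖ (A * X)ᵀ)).PosDef := by
  constructor
  · intro h
    obtain ⟨X, hX, hM⟩ := exists_posDef_lmi_of_roots (B := B.map Complex.ofReal)
      (C := C.map Complex.ofReal) (by ext i j; simp [hB.apply i j]) (by ext i j; simp) h
    refine ⟨X.map Complex.re, hX.map_re.isHermitian, hX.map_re, ?_⟩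
    convert hM.map_re using 1
    ext i j
    simp [mul_apply]
  · rintro ⟨X, -, hX, hM⟩ z hz
    rw [Polynomial.IsRoot, eval_charpoly] at hz
    obtain ⟨v, hv, hvz⟩ := exists_vecMul_eq_zero_iff.mpr hz
    refine hX.map_ofReal.lmi_of_vecMul_eq_smul (A := A.map Complex.ofReal) ?_ hv ?_
    · convert hM.map_ofReal using 1
      ext i j
      simp [mul_apply]
    · rw [vecMul_sub, sub_eq_zero] at hvz
      rw [← hvz]
      ext i
      simp [vecMul_diagonal, mul_comm]
end

section
/- A real n×n matrix A is Hurwitz stable, i.e. every complex eigenvalue z of A satisfies Re(z) < 0, if and only if A = (J − R)Q for some real n×n matrices J, R, Q with Jᵀ = −J, Q symmetric positive definite, and R symmetric positive definite. -/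
open Matrix

open Filter Topology in
theorem exists_pos_forall_norm_one_add_smul_lt_one {S : Set ℂ} (hS : S.Finite)
    (hre : ∀ z ∈ S, z.re < 0) : ∃ ε : ℝ, 0 < ε ∧ ∀ z ∈ S, ‖1 + (ε : ℂ) * z‖ < 1 := by
  have hev : ∀ᶠ ε : ℝ in 𝓝[>] 0, ∀ z ∈ S, ‖1 + (ε : ℂ) * z‖ < 1 := by
    refine (eventually_all_finite hS).2 fun z hz => ?_
    have hneg := hre z hz
    have hsq : 0 < Complex.normSq z := by
      rw [Complex.normSq_apply]
      nlinarith [mul_pos_of_neg_of_neg hneg hneg, mul_self_nonneg z.im]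
    filter_upwards [Ioo_mem_nhdsGT (show 0 < -z.re / Complex.normSq z from
      div_pos (neg_pos.2 hneg) hsq)] with ε hε
    have hlt := (lt_div_iff₀ hsq).1 hε.2
    rw [← abs_of_nonneg (norm_nonneg (1 + (ε : ℂ) * z)), ← sq_lt_one_iff_abs_lt_one,
      ← Complex.normSq_eq_norm_sq, Complex.normSq_apply]
    rw [Complex.normSq_apply] at hlt
    simp only [Complex.add_re, Complex.one_re, Complex.mul_re, Complex.ofReal_re,
      Complex.ofReal_im, Complex.add_im, Complex.one_im, Complex.mul_im, zero_mul, sub_zero,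
      add_zero, zero_add]
    nlinarith [hε.1, mul_lt_mul_of_pos_left hlt hε.1, mul_pos hε.1 (neg_pos.2 hneg)]
  obtain ⟨ε, hε, hpos⟩ := (hev.and self_mem_nhdsWithin).exists
  exact ⟨ε, hpos, hε⟩

open Filter Topology in
theorem exists_norm_pow_succ_lt_one {A : Type*} [NormedRing A] [NormedAlgebra ℂ A]
    [CompleteSpace A] {a : A} (ha : ∀ z ∈ spectrum ℂ a, ‖z‖ < 1) :
    ∃ N : ℕ, ‖a ^ (N + 1)‖ < 1 := by
  have hrad : spectralRadius ℂ a < 1 := by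
    rcases (spectrum ℂ a).eq_empty_or_nonempty with hempty | hne
    · simp [spectralRadius, hempty]
    · exact_mod_cast spectrum.spectralRadius_lt_of_forall_lt_of_nonempty hne (r := 1)
        fun z hz => by exact_mod_cast ha z hz
  have hev := (spectrum.pow_nnnorm_pow_one_div_tendsto_nhds_spectralRadius a).eventually
    (gt_mem_nhds hrad)
  obtain ⟨k, hk, hk1⟩ := (hev.and (eventually_ge_atTop 1)).exists
  obtain ⟨N, rfl⟩ := Nat.exists_eq_add_of_le' hk1
  refine ⟨N, ?_⟩
  by_contra! hge
  refine hk.not_ge (ENNReal.one_le_rpow ?_ (by positivity))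
  exact_mod_cast hge

namespace Matrix

theorem dotProduct_mulVec_self_eq_zero_of_transpose_eq_neg {ι : Type*} [Fintype ι]
    {J : Matrix ι ι ℝ} (hJ : Jᵀ = -J) (x : ι → ℝ) : x ⬝ᵥ (J *ᵥ x) = 0 := by
  have h : x ⬝ᵥ (J *ᵥ x) = -(x ⬝ᵥ (J *ᵥ x)) := by
    conv_lhs => rw [dotProduct_mulVec, ← mulVec_transpose, hJ, dotProduct_comm]
    simp [neg_mulVec]
  linarith

variable {ι : Type*} [Fintype ι] [DecidableEq ι]

open scoped Matrix.Norms.L2Operator in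
theorem posDef_one_sub_transpose_mul_self {C : Matrix ι ι ℝ}
    (hC : ‖C.map Complex.ofReal‖ < 1) : (1 - Cᵀ * C).PosDef := by
  refine PosDef.of_dotProduct_mulVec_pos ?_ fun x hx => ?_
  · simp [IsHermitian, conjTranspose_eq_transpose_of_trivial]
  · have hnorm (v : ι → ℝ) : ‖WithLp.toLp 2 (Complex.ofReal ∘ v)‖ ^ 2 = v ⬝ᵥ v := by
      rw [EuclideanSpace.norm_sq_eq]
      simp [dotProduct, sq]
    have hle := l2_opNorm_mulVec (C.map Complex.ofReal) (WithLp.toLp 2 (Complex.ofReal ∘ x))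
    have hmap : (C.map Complex.ofReal) *ᵥ (Complex.ofReal ∘ x) = Complex.ofReal ∘ (C *ᵥ x) := by
      ext i
      simp [mulVec, dotProduct]
    simp only [hmap] at hle
    have hpos : 0 < x ⬝ᵥ x := by
      simpa using dotProduct_star_self_pos_iff.2 hx
    rw [← hnorm x] at hpos
    have hx0 : 0 < ‖WithLp.toLp 2 (Complex.ofReal ∘ x)‖ := by
      by_contra! h
      simp [le_antisymm h (norm_nonneg _)] at hpos
    have hlt : ‖WithLp.toLp 2 (Complex.ofReal ∘ (C *ᵥ x))‖ ^ 2
        < ‖WithLp.toLp 2 (Complex.ofReal ∘ x)‖ ^ 2 := by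
      refine pow_lt_pow_left₀ (hle.trans_lt ?_) (norm_nonneg _) two_ne_zero
      exact mul_lt_of_lt_one_left hx0 hC
    rw [hnorm, hnorm] at hlt
    have hquad : x ⬝ᵥ ((Cᵀ * C) *ᵥ x) = (C *ᵥ x) ⬝ᵥ (C *ᵥ x) := by
      rw [← mulVec_mulVec, dotProduct_mulVec, vecMul_transpose]
    simpa [sub_mulVec, dotProduct_sub, hquad] using hlt

theorem sum_sub_transpose_mul_sum_mul (B : Matrix ι ι ℝ) (N : ℕ) :
    (∑ k ∈ Finset.range N, (B ^ k)ᵀ * B ^ k)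
      - Bᵀ * (∑ k ∈ Finset.range N, (B ^ k)ᵀ * B ^ k) * B = 1 - (B ^ N)ᵀ * B ^ N := by
  have hshift : Bᵀ * (∑ k ∈ Finset.range N, (B ^ k)ᵀ * B ^ k) * B
      = ∑ k ∈ Finset.range N, (B ^ (k + 1))ᵀ * B ^ (k + 1) := by
    simp only [Finset.mul_sum, Finset.sum_mul, pow_succ, transpose_mul, Matrix.mul_assoc]
  rw [hshift, ← Finset.sum_sub_distrib,
    Finset.sum_range_sub' (fun k => (B ^ k)ᵀ * B ^ k)]
  simp

open scoped Matrix.Norms.L2Operator in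
/-- **Stein's theorem**: a Schur stable real matrix admits a positive definite solution of the
discrete Lyapunov inequality. -/
theorem exists_posDef_sub_transpose_mul_mul_posDef {B : Matrix ι ι ℝ}
    (hB : ∀ z ∈ spectrum ℂ (B.map Complex.ofReal), ‖z‖ < 1) :
    ∃ P : Matrix ι ι ℝ, P.PosDef ∧ (P - Bᵀ * P * B).PosDef := by
  obtain ⟨N, hN⟩ := exists_norm_pow_succ_lt_one hB
  refine ⟨∑ k ∈ Finset.range (N + 1), (B ^ k)ᵀ * B ^ k, ?_, ?_⟩
  · rw [Finset.sum_range_succ']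
    refine PosDef.posSemidef_add (posSemidef_sum _ fun k _ => ?_) (by simpa using PosDef.one)
    simpa [conjTranspose_eq_transpose_of_trivial] using
      posSemidef_conjTranspose_mul_self (B ^ (k + 1))
  · rw [sum_sub_transpose_mul_sum_mul]
    refine posDef_one_sub_transpose_mul_self ?_
    have hpow : (B ^ (N + 1)).map Complex.ofReal = B.map Complex.ofReal ^ (N + 1) :=
      map_pow Complex.ofRealHom.mapMatrix B (N + 1)
    rwa [hpow]

/-- **Lyapunov's theorem**: a Hurwitz stable real matrix admits a positive definite solution of
the continuous Lyapunov inequality. -/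
theorem exists_posDef_neg_lyapunov_posDef {A : Matrix ι ι ℝ}
    (hA : ∀ z ∈ spectrum ℂ (A.map Complex.ofReal), z.re < 0) :
    ∃ P : Matrix ι ι ℝ, P.PosDef ∧ (-(Aᵀ * P + P * A)).PosDef := by
  obtain ⟨ε, hε, hlt⟩ := exists_pos_forall_norm_one_add_smul_lt_one (finite_spectrum _) hA
  have hmap : (1 + ε • A).map Complex.ofReal
      = algebraMap ℂ (Matrix ι ι ℂ) 1 + (ε : ℂ) • A.map Complex.ofReal := by
    ext i j
    simp [one_apply, apply_ite]
  obtain ⟨P, hP, hdiff⟩ := exists_posDef_sub_transpose_mul_mul_posDef (B := 1 + ε • A) (by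
    intro z hz
    rw [hmap, ← spectrum.singleton_add_eq,
      ← Units.smul_mk0 (Complex.ofReal_ne_zero.2 hε.ne'), spectrum.unit_smul_eq_smul] at hz
    obtain ⟨_, rfl, _, ⟨w, hw, rfl⟩, rfl⟩ := hz
    exact hlt w hw)
  refine ⟨P, hP, ?_⟩
  have hquad : (ε • (Aᵀ * P * A)).PosSemidef := by
    have h := (hP.posSemidef.conjTranspose_mul_mul_same A).smul hε.le
    rwa [conjTranspose_eq_transpose_of_trivial] at h
  have hsum := (hdiff.smul (inv_pos.2 hε)).add_posSemidef hquad
  convert hsum using 1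
  have hexp : P - (1 + ε • A)ᵀ * P * (1 + ε • A)
      = ε • (-(Aᵀ * P + P * A) - ε • (Aᵀ * P * A)) := by
    simp only [transpose_add, transpose_one, transpose_smul, Matrix.add_mul, Matrix.mul_add,
      Matrix.one_mul, Matrix.mul_one, Matrix.smul_mul, Matrix.mul_smul]
    module
  rw [hexp, inv_smul_smul₀ hε.ne', sub_add_cancel]

theorem exists_eq_skew_sub_posDef_mul_posDef {A P : Matrix ι ι ℝ} (hP : P.PosDef)
    (hL : (-(Aᵀ * P + P * A)).PosDef) :
    ∃ J R Q : Matrix ι ι ℝ, Jᵀ = -J ∧ R.PosDef ∧ Q.PosDef ∧ A = (J - R) * Q := by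
  have hdet : IsUnit P.det := (isUnit_iff_isUnit_det P).1 hP.isUnit
  have hPt : P⁻¹ᵀ = P⁻¹ := by
    simpa [IsHermitian, conjTranspose_eq_transpose_of_trivial] using hP.inv.isHermitian
  refine ⟨(2⁻¹ : ℝ) • (A * P⁻¹ - P⁻¹ * Aᵀ), (2⁻¹ : ℝ) • (P⁻¹ * -(Aᵀ * P + P * A) * P⁻¹), P,
    ?_, ?_, hP, ?_⟩
  · simp only [transpose_smul, transpose_sub, transpose_mul, transpose_transpose, hPt]
    module
  · have h := hL.conjTranspose_mul_mul_same (mulVec_injective_of_isUnit hP.inv.isUnit)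
    rw [conjTranspose_eq_transpose_of_trivial, hPt] at h
    exact h.smul (by norm_num)
  · have hexp : P⁻¹ * -(Aᵀ * P + P * A) * P⁻¹ = -(P⁻¹ * Aᵀ + A * P⁻¹) := by
      simp only [Matrix.mul_neg, Matrix.neg_mul, Matrix.mul_add, Matrix.add_mul]
      rw [nonsing_inv_mul_cancel_left _ _ hdet, ← Matrix.mul_assoc,
        mul_nonsing_inv_cancel_right _ _ hdet]
    have hsub : (2⁻¹ : ℝ) • (A * P⁻¹ - P⁻¹ * Aᵀ)
        - (2⁻¹ : ℝ) • (P⁻¹ * -(Aᵀ * P + P * A) * P⁻¹) = A * P⁻¹ := by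
      rw [hexp]
      module
    rw [hsub, nonsing_inv_mul_cancel_right _ _ hdet]

/-- An eigenvalue of a real matrix, in terms of the real and imaginary parts of an eigenvector. -/
theorem exists_real_mulVec_eq_of_mem_spectrum {A : Matrix ι ι ℝ} {z : ℂ}
    (hz : z ∈ spectrum ℂ (A.map Complex.ofReal)) :
    ∃ a b : ι → ℝ, (a ≠ 0 ∨ b ≠ 0) ∧ A *ᵥ a = z.re • a - z.im • b ∧
      A *ᵥ b = z.im • a + z.re • b := by
  rw [← spectrum_toLin', ← Module.End.hasEigenvalue_iff_mem_spectrum] at hz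
  obtain ⟨v, hv⟩ := hz.exists_hasEigenvector
  have hval (i : ι) : ((A.map Complex.ofReal) *ᵥ v) i = z * v i := by
    simpa using congrFun hv.apply_eq_smul i
  refine ⟨fun i => (v i).re, fun i => (v i).im, ?_, ?_, ?_⟩
  · by_contra! h
    exact hv.2 (funext fun i => Complex.ext (congrFun h.1 i) (congrFun h.2 i))
  · ext i
    simpa [mulVec, dotProduct] using congrArg Complex.re (hval i)
  · ext i
    simpa [mulVec, dotProduct, add_comm] using congrArg Complex.im (hval i)

theorem re_neg_of_mem_spectrum_skew_sub_posDef_mul_posDef {J R Q : Matrix ι ι ℝ}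
    (hJ : Jᵀ = -J) (hR : R.PosDef) (hQ : Q.PosDef) {z : ℂ}
    (hz : z ∈ spectrum ℂ (((J - R) * Q).map Complex.ofReal)) : z.re < 0 := by
  obtain ⟨a, b, hab, ha, hb⟩ := exists_real_mulVec_eq_of_mem_spectrum hz
  have hQt : Qᵀ = Q := by
    simpa [IsHermitian, conjTranspose_eq_transpose_of_trivial] using hQ.isHermitian
  have hsymm (x y : ι → ℝ) : (Q *ᵥ x) ⬝ᵥ y = x ⬝ᵥ (Q *ᵥ y) := by
    rw [dotProduct_mulVec, ← mulVec_transpose, hQt]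
  have hquad (x : ι → ℝ) : (Q *ᵥ x) ⬝ᵥ (((J - R) * Q) *ᵥ x)
      = -((Q *ᵥ x) ⬝ᵥ (R *ᵥ (Q *ᵥ x))) := by
    rw [← mulVec_mulVec, sub_mulVec, dotProduct_sub,
      dotProduct_mulVec_self_eq_zero_of_transpose_eq_neg hJ, zero_sub]
  have hQinj := mulVec_injective_of_isUnit hQ.isUnit
  have hRpos {x : ι → ℝ} (hx : x ≠ 0) : 0 < (Q *ᵥ x) ⬝ᵥ (R *ᵥ (Q *ᵥ x)) := by
    simpa using hR.dotProduct_mulVec_pos ((hQinj.ne_iff' (mulVec_zero Q)).2 hx)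
  have hQpos {x : ι → ℝ} (hx : x ≠ 0) : 0 < x ⬝ᵥ (Q *ᵥ x) := by
    simpa using hQ.dotProduct_mulVec_pos hx
  have hRnonneg (x : ι → ℝ) : 0 ≤ (Q *ᵥ x) ⬝ᵥ (R *ᵥ (Q *ᵥ x)) := by
    simpa using hR.posSemidef.dotProduct_mulVec_nonneg (Q *ᵥ x)
  have hQnonneg (x : ι → ℝ) : 0 ≤ x ⬝ᵥ (Q *ᵥ x) := by
    simpa using hQ.posSemidef.dotProduct_mulVec_nonneg x
  have hqa := hquad a
  have hqb := hquad b
  rw [ha, dotProduct_sub, dotProduct_smul, dotProduct_smul, hsymm a b,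
    dotProduct_comm _ a] at hqa
  rw [hb, dotProduct_add, dotProduct_smul, dotProduct_smul, dotProduct_comm _ a,
    dotProduct_comm _ b] at hqb
  simp only [smul_eq_mul] at hqa hqb
  have hid : z.re * (a ⬝ᵥ (Q *ᵥ a) + b ⬝ᵥ (Q *ᵥ b))
      = -((Q *ᵥ a) ⬝ᵥ (R *ᵥ (Q *ᵥ a)) + (Q *ᵥ b) ⬝ᵥ (R *ᵥ (Q *ᵥ b))) := by
    linarith
  have hneg : z.re * (a ⬝ᵥ (Q *ᵥ a) + b ⬝ᵥ (Q *ᵥ b)) < 0 := by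
    rw [hid, neg_lt_zero]
    rcases hab with h | h
    · exact add_pos_of_pos_of_nonneg (hRpos h) (hRnonneg b)
    · exact add_pos_of_nonneg_of_pos (hRnonneg a) (hRpos h)
  exact neg_of_mul_neg_left hneg (add_nonneg (hQnonneg a) (hQnonneg b))

end Matrix

/-- DH characterization of Hurwitz stable matrices: all eigenvalues of `A` have negative
real part iff `A = (J - R) Q` with `Jᵀ = -J`, `R ≻ 0`, and `Q ≻ 0`. -/
theorem hurwitz_stable_iff_DH {n : ℕ} (A : Matrix (Fin n) (Fin n) ℝ) :
    (∀ z : ℂ, ((A.map Complex.ofReal).charpoly).IsRoot z → z.re < 0)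
    ↔ ∃ J R Q : Matrix (Fin n) (Fin n) ℝ, Jᵀ = -J ∧ R.PosDef ∧ Q.PosDef ∧
        A = (J - R) * Q := by
  simp only [← mem_spectrum_iff_isRoot_charpoly]
  constructor
  · intro h
    obtain ⟨P, hP, hL⟩ := exists_posDef_neg_lyapunov_posDef h
    exact exists_eq_skew_sub_posDef_mul_posDef hP hL
  · rintro ⟨J, R, Q, hJ, hR, hQ, rfl⟩ z hz
    exact re_neg_of_mem_spectrum_skew_sub_posDef_mul_posDef hJ hR hQ hz
end

section
/- Let a ∈ ℝ and θ ∈ (0, π/2], and let Ω be the left conic sector Ω = {x + iy ∈ ℂ : |y|·cos(θ) < (a − x)·sin(θ)}. A real n×n matrix A has all of its complex eigenvalues in Ω if and only if A = (J − R)Q for some real n×n matrices J, R, Q with Jᵀ = −J, Rᵀ = R, Q symmetric positive definite, and such that the real symmetric 2n×2n block matrix [[sin(θ)(aQ⁻¹ + R), −cos(θ)J], [cos(θ)J, sin(θ)(aQ⁻¹ + R)]] is positive definite. -/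
open Matrix

/-- Triangularization with arbitrarily small off-diagonal part: every endomorphism of a
finite-dimensional complex space is nearly diagonal in a suitable basis. -/
theorem exists_basis_nearly_diagonal {n : ℕ} {V : Type*} [AddCommGroup V] [Module ℂ V]
    [FiniteDimensional ℂ V] (hn : Module.finrank ℂ V = n) (f : Module.End ℂ V)
    {δ : ℝ} (hδ : 0 < δ) :
    ∃ (b : Module.Basis (Fin n) ℂ V) (d : Fin n → ℂ), (∀ i, f.HasEigenvalue (d i)) ∧
      ∀ i j, ‖b.repr (f (b i) - d i • b i) j‖ ≤ δ := by
  induction n generalizing V with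
  | zero =>
    exact ⟨Module.finBasisOfFinrankEq ℂ V hn, 0, fun i => i.elim0, fun i => i.elim0⟩
  | succ n ih =>
    have : Nontrivial V := Module.nontrivial_of_finrank_pos (R := ℂ) (by omega)
    obtain ⟨μ, hμ⟩ := f.exists_eigenvalue
    set g : V →ₗ[ℂ] V := f - μ • LinearMap.id with hg
    have hg_apply (v : V) : g v = f v - μ • v := by simp [hg]
    have hrange : LinearMap.range g < ⊤ := by
      rw [lt_top_iff_ne_top, Ne, LinearMap.range_eq_top, ← LinearMap.injective_iff_surjective]
      intro hinj
      obtain ⟨v, hv⟩ := hμ.exists_hasEigenvector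
      exact hv.2 (hinj (by rw [hg_apply, hv.apply_eq_smul, sub_self, map_zero]))
    obtain ⟨φ, hφ, hφg⟩ := Submodule.exists_le_ker_of_lt_top _ hrange
    have hgW (v : V) : f v - μ • v ∈ LinearMap.ker φ := hφg ⟨v, hg_apply v⟩
    have hfW : ∀ w ∈ LinearMap.ker φ, f w ∈ LinearMap.ker φ := fun w hw => by
      simpa using add_mem (hgW w) (Submodule.smul_mem _ μ hw)
    have hdim : Module.finrank ℂ (LinearMap.ker φ) = n := by
      have := Module.Dual.finrank_ker_add_one_of_ne_zero (f := φ) hφ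
      omega
    obtain ⟨b, d, hd, hb⟩ := ih hdim (f.restrict hfW)
    obtain ⟨e, he⟩ : ∃ e, φ e ≠ 0 := by
      by_contra! h
      exact hφ (LinearMap.ext h)
    set w : LinearMap.ker φ := ⟨f e - μ • e, hgW e⟩ with hw
    obtain ⟨t, ht, htδ⟩ : ∃ t : ℝ, 0 < t ∧ ∀ j, t * ‖b.repr w j‖ ≤ δ := by
      refine ⟨δ / (1 + ∑ j, ‖b.repr w j‖), by positivity, fun j => ?_⟩
      have h1 : ‖b.repr w j‖ ≤ ∑ j, ‖b.repr w j‖ :=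
        Finset.single_le_sum (f := fun j => ‖b.repr w j‖) (fun _ _ => norm_nonneg _)
          (Finset.mem_univ j)
      have h2 : 0 < 1 + ∑ j, ‖b.repr w j‖ := by positivity
      rw [div_mul_eq_mul_div, div_le_iff₀ h2]
      nlinarith
    have hy : φ ((t : ℂ) • e) ≠ 0 := by simp [he, ht.ne']
    have hli : ∀ c : ℂ, ∀ x ∈ LinearMap.ker φ, c • ((t : ℂ) • e) + x = 0 → c = 0 := by
      intro c x hx h
      have := congrArg φ h
      rw [map_add, LinearMap.mem_ker.1 hx, map_smul, add_zero, map_zero, smul_eq_mul] at this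
      exact (mul_eq_zero.1 this).resolve_right hy
    have hsp : ∀ z : V, ∃ c : ℂ, z + c • ((t : ℂ) • e) ∈ LinearMap.ker φ := fun z =>
      ⟨-(φ z / φ ((t : ℂ) • e)), by
        rw [LinearMap.mem_ker, map_add, map_smul, smul_eq_mul, neg_mul, div_mul_cancel₀ _ hy,
          add_neg_cancel]⟩
    set B := Module.Basis.mkFinCons ((t : ℂ) • e) b hli hsp with hB
    have hB0 : B 0 = (t : ℂ) • e := by simp [hB]
    have hBs (i : Fin n) : B i.succ = b i := by simp [hB]
    have hrepr (x : LinearMap.ker φ) (r : ℝ) (hr : 0 ≤ r) (h : ∀ j, ‖b.repr x j‖ ≤ r)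
        (j : Fin (n + 1)) : ‖B.repr (x : V) j‖ ≤ r := by
      have hx : (x : V) = ∑ i, b.repr x i • B i.succ := by
        have h := congrArg (LinearMap.ker φ).subtype (b.sum_repr x)
        rw [map_sum] at h
        simpa only [hBs, map_smul, Submodule.subtype_apply] using h.symm
      rw [hx, map_sum, Finsupp.finsetSum_apply]
      refine Fin.cases ?_ (fun j => ?_) j
      · simpa [Finsupp.single_apply] using hr
      · simpa [Finsupp.single_apply] using h j
    refine ⟨B, Fin.cons μ d, Fin.cases hμ fun i => ?_, Fin.cases (fun j => ?_) fun i j => ?_⟩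
    · obtain ⟨v, hv⟩ := (hd i).exists_hasEigenvector
      refine Module.End.hasEigenvalue_of_hasEigenvector (x := (v : V))
        (Module.End.hasEigenvector_iff.2 ⟨Module.End.mem_eigenspace_iff.2 ?_, by simpa using hv.2⟩)
      simpa using congrArg Subtype.val hv.apply_eq_smul
    · have h := hrepr ((t : ℂ) • w) δ hδ.le (fun j => by
        rw [map_smul, Finsupp.smul_apply, norm_smul, Complex.norm_real, Real.norm_of_nonneg ht.le]
        exact htδ j) j
      convert h using 4
      rw [Fin.cons_zero, hB0, Submodule.coe_smul, hw, map_smul, smul_sub, smul_comm μ (t : ℂ)]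
    · have h := hrepr (f.restrict hfW (b i) - d i • b i) δ hδ.le (hb i) j
      convert h using 4
      simp [hBs]

theorem norm_star_dotProduct_mulVec_le {n : ℕ} (E : Matrix (Fin n) (Fin n) ℂ) {δ : ℝ}
    (hE : ∀ i j, ‖E i j‖ ≤ δ) (x : Fin n → ℂ) :
    ‖star x ⬝ᵥ (E *ᵥ x)‖ ≤ δ * n * ∑ i, ‖x i‖ ^ 2 := by
  have key (i j : Fin n) : ‖star (x i) * (E i j * x j)‖ ≤ δ * ((‖x i‖ ^ 2 + ‖x j‖ ^ 2) / 2) := by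
    rw [norm_mul, norm_mul, norm_star]
    have h1 := hE i j
    have h0 : 0 ≤ δ := (norm_nonneg _).trans h1
    calc ‖x i‖ * (‖E i j‖ * ‖x j‖) = ‖E i j‖ * (‖x i‖ * ‖x j‖) := by ring
      _ ≤ δ * (‖x i‖ * ‖x j‖) := by gcongr
      _ ≤ _ := by gcongr; nlinarith [sq_nonneg (‖x i‖ - ‖x j‖)]
  calc ‖star x ⬝ᵥ (E *ᵥ x)‖ = ‖∑ i, ∑ j, star (x i) * (E i j * x j)‖ := by
        simp [dotProduct, mulVec, Finset.mul_sum]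
    _ ≤ ∑ i, ∑ j, ‖star (x i) * (E i j * x j)‖ :=
        (norm_sum_le _ _).trans (Finset.sum_le_sum fun i _ => norm_sum_le _ _)
    _ ≤ ∑ i, ∑ j, δ * ((‖x i‖ ^ 2 + ‖x j‖ ^ 2) / 2) :=
        Finset.sum_le_sum fun i _ => Finset.sum_le_sum fun j _ => key i j
    _ = δ * n * ∑ i, ‖x i‖ ^ 2 := by
        simp only [← Finset.mul_sum, ← Finset.sum_div, Finset.sum_add_distrib, Finset.sum_const,
          Finset.card_univ, Fintype.card_fin, nsmul_eq_mul]
        ring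

open scoped ComplexOrder in
/-- If the spectrum of `C` lies in the left conic sector, then so does its numerical range with
respect to a suitable inner product. -/
theorem exists_posDef_numerical_range_mem_sector {n : ℕ} {a s c : ℝ} (hs0 : 0 ≤ s) (hs1 : s ≤ 1)
    (hc0 : 0 ≤ c) (hc1 : c ≤ 1) (C : Matrix (Fin n) (Fin n) ℂ)
    (h : ∀ z, C.charpoly.IsRoot z → |z.im| * c < (a - z.re) * s) :
    ∃ K : Matrix (Fin n) (Fin n) ℂ, K.PosDef ∧ ∀ z : Fin n → ℂ, z ≠ 0 →
      |(star z ⬝ᵥ ((K * C) *ᵥ z)).im| * c <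
        s * (a * (star z ⬝ᵥ (K *ᵥ z)).re - (star z ⬝ᵥ ((K * C) *ᵥ z)).re) := by
  obtain ⟨m, hm, hroot⟩ : ∃ m : ℝ, 0 < m ∧ ∀ z, C.charpoly.IsRoot z →
      m ≤ (a - z.re) * s - |z.im| * c := by
    have hfin (S : Finset ℂ) (hS : ∀ z ∈ S, 0 < (a - z.re) * s - |z.im| * c) :
        ∃ m : ℝ, 0 < m ∧ ∀ z ∈ S, m ≤ (a - z.re) * s - |z.im| * c := by
      rcases S.eq_empty_or_nonempty with rfl | hne
      · exact ⟨1, one_pos, by simp⟩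
      · obtain ⟨z, hz, hmin⟩ := S.exists_min_image (fun z => (a - z.re) * s - |z.im| * c) hne
        exact ⟨_, hS z hz, hmin⟩
    have hmem (z : ℂ) : z ∈ C.charpoly.roots.toFinset ↔ C.charpoly.IsRoot z := by
      rw [Multiset.mem_toFinset, Polynomial.mem_roots C.charpoly_monic.ne_zero]
    obtain ⟨m, hm, hle⟩ := hfin C.charpoly.roots.toFinset fun z hz =>
      sub_pos.2 (h z ((hmem z).1 hz))
    exact ⟨m, hm, fun z hz => hle z ((hmem z).2 hz)⟩
  set δ : ℝ := m / (4 * (n + 1)) with hδ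
  have hδ0 : 0 < δ := by positivity
  have hδn : 2 * (δ * n) < m := by
    have : δ * (4 * (n + 1)) = m := by rw [hδ]; field_simp
    nlinarith
  obtain ⟨b, d, hd, hb⟩ := exists_basis_nearly_diagonal (Module.finrank_fin_fun ℂ) (Matrix.toLin' C) hδ0
  set W : Matrix (Fin n) (Fin n) ℂ := LinearMap.toMatrix' b.equivFun.toLinearMap with hW
  set T := LinearMap.toMatrix b b (Matrix.toLin' C) with hT
  have hWv (z : Fin n → ℂ) : W *ᵥ z = b.repr z := by
    rw [hW, LinearMap.toMatrix'_mulVec]; rfl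
  have hWinj : Function.Injective W.mulVec := fun x y hxy => by
    simp only [hWv] at hxy
    exact b.repr.injective (DFunLike.coe_injective hxy)
  have hWC : W * C = T * W := by
    refine Matrix.ext_of_mulVec_single fun i => ?_
    rw [← mulVec_mulVec, ← mulVec_mulVec, hWv, hWv, hT, LinearMap.toMatrix_mulVec_repr,
      Matrix.toLin'_apply]
  have hE (i j : Fin n) : ‖(T - diagonal d) i j‖ ≤ δ := by
    refine le_of_eq_of_le ?_ (hb j i)
    rw [map_sub, map_smul, b.repr_self, Matrix.sub_apply, hT, LinearMap.toMatrix_apply,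
      Finsupp.sub_apply, Finsupp.smul_apply, Finsupp.single_apply, diagonal_apply]
    by_cases hij : i = j <;> simp [hij, eq_comm]
  refine ⟨Wᴴ * W, Matrix.PosDef.conjTranspose_mul_self W hWinj, fun z hz => ?_⟩
  set x := W *ᵥ z with hx
  have hx0 : x ≠ 0 := fun h0 => hz (hWinj (by simpa using h0))
  set q : ℝ := ∑ i, ‖x i‖ ^ 2 with hq
  have hqpos : 0 < q := by
    obtain ⟨i, hi⟩ := Function.ne_iff.1 hx0
    exact Finset.sum_pos' (fun _ _ => by positivity) ⟨i, Finset.mem_univ i, by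
      have : 0 < ‖x i‖ := norm_pos_iff.2 hi
      positivity⟩
  have hK : (star z ⬝ᵥ ((Wᴴ * W) *ᵥ z)).re = q := by
    rw [← mulVec_mulVec, dotProduct_mulVec, ← star_mulVec, ← hx, hq]
    simp [dotProduct, ← Complex.normSq_apply, Complex.normSq_eq_norm_sq]
  have hKC : star z ⬝ᵥ ((Wᴴ * W * C) *ᵥ z) =
      star x ⬝ᵥ ((T - diagonal d) *ᵥ x) + ∑ i, d i * (‖x i‖ ^ 2 : ℝ) := by
    rw [Matrix.mul_assoc, hWC, ← mulVec_mulVec, dotProduct_mulVec, ← star_mulVec, ← mulVec_mulVec,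
      ← hx, sub_mulVec, dotProduct_sub]
    have : star x ⬝ᵥ (diagonal d *ᵥ x) = ∑ i, d i * (‖x i‖ ^ 2 : ℝ) := by
      refine Finset.sum_congr rfl fun i _ => ?_
      rw [mulVec_diagonal, Pi.star_apply, ← Complex.normSq_eq_norm_sq, ← Complex.mul_conj]
      simp; ring
    rw [this, sub_add_cancel]
  have hbound := norm_star_dotProduct_mulVec_le _ hE x
  rw [hK, hKC]
  set ε := star x ⬝ᵥ ((T - diagonal d) *ᵥ x)
  have hre := (abs_le.1 ((Complex.abs_re_le_norm ε).trans hbound)).2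
  have him := (Complex.abs_im_le_norm ε).trans hbound
  rw [Complex.add_re, Complex.add_im, Complex.re_sum, Complex.im_sum]
  simp only [Complex.re_mul_ofReal, Complex.im_mul_ofReal]
  rw [← hq] at hre him
  have hdi (i : Fin n) := hroot (d i) (by
    have := hd i
    rwa [Module.End.hasEigenvalue_iff_isRoot_charpoly, Matrix.charpoly_toLin'] at this)
  have hsum : m * q ≤ s * (a * q) - s * ∑ i, (d i).re * ‖x i‖ ^ 2
      - c * ∑ i, |(d i).im| * ‖x i‖ ^ 2 := by
    rw [hq]
    simp only [Finset.mul_sum, ← Finset.sum_sub_distrib]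
    refine Finset.sum_le_sum fun i _ => ?_
    nlinarith [hdi i, sq_nonneg ‖x i‖]
  have habs : |ε.im + ∑ i, (d i).im * ‖x i‖ ^ 2| ≤
      δ * n * q + ∑ i, |(d i).im| * ‖x i‖ ^ 2 := by
    refine (abs_add_le _ _).trans (add_le_add him ?_)
    refine (Finset.abs_sum_le_sum_abs _ _).trans_eq (Finset.sum_congr rfl fun i _ => ?_)
    rw [abs_mul, abs_of_nonneg (sq_nonneg ‖x i‖)]
  have hη : 0 ≤ δ * n * q := by positivity
  nlinarith [mul_le_mul_of_nonneg_right habs hc0, mul_le_mul_of_nonneg_left hre hs0,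
    mul_le_mul_of_nonneg_right hs1 hη, mul_le_mul_of_nonneg_right hc1 hη,
    mul_lt_mul_of_pos_right hδn hqpos]

/-- The complex vector with real part `x` and imaginary part `y`. -/
private noncomputable def ofReIm {n : ℕ} (x y : Fin n → ℝ) : Fin n → ℂ := fun i => ⟨x i, y i⟩

private theorem re_star_ofReIm_dotProduct_mulVec {n : ℕ} (M : Matrix (Fin n) (Fin n) ℂ)
    (x y : Fin n → ℝ) :
    (star (ofReIm x y) ⬝ᵥ (M *ᵥ ofReIm x y)).re =
      x ⬝ᵥ (M.map Complex.re *ᵥ x) + y ⬝ᵥ (M.map Complex.re *ᵥ y)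
        - x ⬝ᵥ (M.map Complex.im *ᵥ y) + y ⬝ᵥ (M.map Complex.im *ᵥ x) := by
  simp only [dotProduct, mulVec, Finset.mul_sum, ← Finset.sum_add_distrib,
    ← Finset.sum_sub_distrib, Complex.re_sum]
  refine Finset.sum_congr rfl fun i _ => Finset.sum_congr rfl fun j _ => ?_
  simp [ofReIm]
  ring

private theorem im_star_ofReIm_dotProduct_mulVec {n : ℕ} (M : Matrix (Fin n) (Fin n) ℂ)
    (x y : Fin n → ℝ) :
    (star (ofReIm x y) ⬝ᵥ (M *ᵥ ofReIm x y)).im =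
      x ⬝ᵥ (M.map Complex.re *ᵥ y) - y ⬝ᵥ (M.map Complex.re *ᵥ x)
        + x ⬝ᵥ (M.map Complex.im *ᵥ x) + y ⬝ᵥ (M.map Complex.im *ᵥ y) := by
  simp only [dotProduct, mulVec, Finset.mul_sum, ← Finset.sum_add_distrib,
    ← Finset.sum_sub_distrib, Complex.im_sum]
  refine Finset.sum_congr rfl fun i _ => Finset.sum_congr rfl fun j _ => ?_
  simp [ofReIm]
  ring

private theorem ofReIm_ne_zero {n : ℕ} {x y : Fin n → ℝ} (h : x ≠ 0 ∨ y ≠ 0) :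
    ofReIm x y ≠ 0 := by
  contrapose! h
  exact ⟨funext fun i => congrArg Complex.re (congrFun h i),
    funext fun i => congrArg Complex.im (congrFun h i)⟩

private theorem sumElim_dotProduct_fromBlocks_mulVec {n : ℕ} (S J : Matrix (Fin n) (Fin n) ℝ)
    (c : ℝ) (x y : Fin n → ℝ) :
    Sum.elim x y ⬝ᵥ (fromBlocks S (-c • J) (c • J) S *ᵥ Sum.elim x y) =
      x ⬝ᵥ (S *ᵥ x) + y ⬝ᵥ (S *ᵥ y) + c * (y ⬝ᵥ (J *ᵥ x) - x ⬝ᵥ (J *ᵥ y)) := by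
  simp only [fromBlocks_mulVec, Sum.elim_comp_inl, Sum.elim_comp_inr, sumElim_dotProduct_sumElim,
    dotProduct_add, smul_mulVec, dotProduct_smul, smul_eq_mul]
  ring

private theorem dotProduct_mulVec_comm_transpose {n : ℕ} (M : Matrix (Fin n) (Fin n) ℝ)
    (x y : Fin n → ℝ) : x ⬝ᵥ (Mᵀ *ᵥ y) = y ⬝ᵥ (M *ᵥ x) := by
  rw [mulVec_transpose, dotProduct_comm, dotProduct_mulVec]

open scoped ComplexOrder in
private theorem Matrix.PosDef.map_re_s4 {n : ℕ} {K : Matrix (Fin n) (Fin n) ℂ} (hK : K.PosDef) :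
    (K.map Complex.re).PosDef := by
  refine .of_dotProduct_mulVec_pos ?_ fun x hx => ?_
  · ext i j
    simpa using congrArg Complex.re (congrFun (congrFun hK.1 i) j)
  · have h := (Complex.pos_iff.1 (hK.dotProduct_mulVec_pos (ofReIm_ne_zero (y := 0) (.inl hx)))).1
    rw [re_star_ofReIm_dotProduct_mulVec] at h
    simpa using h

theorem exists_DH_of_spectrum_mem_sector {n : ℕ} {a s c : ℝ} (hs0 : 0 ≤ s) (hs1 : s ≤ 1)
    (hc0 : 0 ≤ c) (hc1 : c ≤ 1) (A : Matrix (Fin n) (Fin n) ℝ)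
    (h : ∀ z : ℂ, (A.map Complex.ofReal).charpoly.IsRoot z → |z.im| * c < (a - z.re) * s) :
    ∃ J R Q : Matrix (Fin n) (Fin n) ℝ, Jᵀ = -J ∧ Rᵀ = R ∧ Q.PosDef ∧ A = (J - R) * Q ∧
      (fromBlocks (s • (a • Q⁻¹ + R)) (-c • J) (c • J) (s • (a • Q⁻¹ + R))).PosDef := by
  obtain ⟨K, hK, hKC⟩ := exists_posDef_numerical_range_mem_sector hs0 hs1 hc0 hc1
    (A.map Complex.ofReal)ᵀ (by simpa only [charpoly_transpose] using h)
  set P := K.map Complex.re with hP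
  have hPpos : P.PosDef := hK.map_re_s4
  have hPt : Pᵀ = P := by simpa [IsHermitian, conjTranspose_eq_transpose_of_trivial] using hPpos.1
  have hG : (K * (A.map Complex.ofReal)ᵀ).map Complex.re = P * Aᵀ := by
    ext i j
    simp [hP, Matrix.mul_apply]
  set G := P * Aᵀ with hGdef
  have hGt : Gᵀ = A * P := by rw [hGdef, transpose_mul, transpose_transpose, hPt]
  have hdet : IsUnit P.det := (isUnit_iff_isUnit_det P).1 hPpos.isUnit
  have hJ : ((1 / 2 : ℝ) • (Gᵀ - G))ᵀ = -((1 / 2 : ℝ) • (Gᵀ - G)) := by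
    rw [transpose_smul, transpose_sub, transpose_transpose, ← smul_neg, neg_sub]
  have hR : (-(1 / 2 : ℝ) • (Gᵀ + G))ᵀ = -(1 / 2 : ℝ) • (Gᵀ + G) := by
    rw [transpose_smul, transpose_add, transpose_transpose, add_comm]
  refine ⟨(1 / 2 : ℝ) • (Gᵀ - G), -(1 / 2 : ℝ) • (Gᵀ + G), P⁻¹, hJ, hR, hPpos.inv, ?_, ?_⟩
  · have : (1 / 2 : ℝ) • (Gᵀ - G) - -(1 / 2 : ℝ) • (Gᵀ + G) = A * P := by
      rw [← hGt]; module
    rw [this, mul_nonsing_inv_cancel_right _ _ hdet]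
  rw [nonsing_inv_nonsing_inv _ hdet]
  refine .of_dotProduct_mulVec_pos ?_ fun u hu => ?_
  · have hS : (s • (a • P + -(1 / 2 : ℝ) • (Gᵀ + G))).IsHermitian := by
      rw [IsHermitian, conjTranspose_eq_transpose_of_trivial, transpose_smul, transpose_add,
        transpose_smul, hPt, hR]
    refine hS.fromBlocks ?_ hS
    rw [conjTranspose_eq_transpose_of_trivial, transpose_smul, hJ, neg_smul, smul_neg, neg_neg]
  obtain ⟨x, y, rfl⟩ : ∃ x y, u = Sum.elim x y := ⟨_, _, (Sum.elim_comp_inl_inr u).symm⟩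
  have hxy : x ≠ 0 ∨ y ≠ 0 := by
    contrapose! hu
    rw [hu.1, hu.2]
    exact Sum.elim_zero_zero
  have h1 := hKC _ (ofReIm_ne_zero hxy)
  have h2 := hKC _ (ofReIm_ne_zero (y := -y) (hxy.imp_right neg_ne_zero.2))
  rw [re_star_ofReIm_dotProduct_mulVec, im_star_ofReIm_dotProduct_mulVec,
    re_star_ofReIm_dotProduct_mulVec, hG, ← hP] at h1 h2
  simp only [mulVec_neg, dotProduct_neg, neg_dotProduct, neg_neg] at h2
  have h1' := mul_le_mul_of_nonneg_right (neg_abs_le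
    (x ⬝ᵥ (G *ᵥ y) - y ⬝ᵥ (G *ᵥ x) +
      x ⬝ᵥ ((K * (A.map Complex.ofReal)ᵀ).map Complex.im *ᵥ x) +
      y ⬝ᵥ ((K * (A.map Complex.ofReal)ᵀ).map Complex.im *ᵥ y))) hc0
  have h2' := (mul_le_mul_of_nonneg_right (le_abs_self _) hc0).trans_lt h2
  rw [star_trivial, sumElim_dotProduct_fromBlocks_mulVec]
  simp only [smul_mulVec, add_mulVec, sub_mulVec, dotProduct_smul, dotProduct_add, dotProduct_sub,
    smul_eq_mul, dotProduct_mulVec_comm_transpose]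
  linarith

theorem mem_sector_of_DH {n : ℕ} {a s c : ℝ} {J R Q : Matrix (Fin n) (Fin n) ℝ}
    (hJ : Jᵀ = -J) (hR : Rᵀ = R) (hQ : Q.PosDef)
    (hB : (fromBlocks (s • (a • Q⁻¹ + R)) (-c • J) (c • J) (s • (a • Q⁻¹ + R))).PosDef)
    {z : ℂ} (hz : (((J - R) * Q).map Complex.ofReal).charpoly.IsRoot z) :
    |z.im| * c < (a - z.re) * s := by
  rw [← Matrix.charpoly_toLin', ← Module.End.hasEigenvalue_iff_isRoot_charpoly] at hz
  obtain ⟨w, hw⟩ := hz.exists_hasEigenvector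
  have hwz := hw.apply_eq_smul
  rw [Matrix.toLin'_apply] at hwz
  set w₁ : Fin n → ℝ := fun i => (w i).re with hw₁
  set w₂ : Fin n → ℝ := fun i => (w i).im with hw₂
  have hre : ((J - R) * Q) *ᵥ w₁ = z.re • w₁ - z.im • w₂ := by
    ext i
    simpa [mulVec, dotProduct] using congrArg Complex.re (congrFun hwz i)
  have him : ((J - R) * Q) *ᵥ w₂ = z.im • w₁ + z.re • w₂ := by
    ext i
    simpa [mulVec, dotProduct, add_comm] using congrArg Complex.im (congrFun hwz i)
  have hdet : IsUnit Q.det := (isUnit_iff_isUnit_det Q).1 hQ.isUnit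
  have hPt : Q⁻¹ᵀ = Q⁻¹ := by
    simpa [IsHermitian, conjTranspose_eq_transpose_of_trivial] using hQ.inv.1
  set x := Q *ᵥ w₁ with hx
  set y := Q *ᵥ w₂ with hy
  have hPx : w₁ = Q⁻¹ *ᵥ x := by rw [hx, mulVec_mulVec, nonsing_inv_mul _ hdet, one_mulVec]
  have hPy : w₂ = Q⁻¹ *ᵥ y := by rw [hy, mulVec_mulVec, nonsing_inv_mul _ hdet, one_mulVec]
  rw [← mulVec_mulVec, sub_mulVec] at hre him
  rw [← hx, hPx, hPy] at hre
  rw [← hy, hPx, hPy] at him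
  have hxy : x ≠ 0 ∨ y ≠ 0 := by
    by_contra! h
    rw [h.1, mulVec_zero] at hPx
    rw [h.2, mulVec_zero] at hPy
    exact hw.2 (funext fun i => Complex.ext (congrFun hPx i) (congrFun hPy i))
  have hsymm : y ⬝ᵥ (Q⁻¹ *ᵥ x) = x ⬝ᵥ (Q⁻¹ *ᵥ y) := by
    rw [← dotProduct_mulVec_comm_transpose, hPt]
  have hRsymm : y ⬝ᵥ (R *ᵥ x) = x ⬝ᵥ (R *ᵥ y) := by
    rw [← dotProduct_mulVec_comm_transpose, hR]
  have hJself (v : Fin n → ℝ) : v ⬝ᵥ (J *ᵥ v) = 0 := by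
    have := dotProduct_mulVec_comm_transpose J v v
    rw [hJ, neg_mulVec, dotProduct_neg] at this
    linarith
  have hq : 0 < x ⬝ᵥ (Q⁻¹ *ᵥ x) + y ⬝ᵥ (Q⁻¹ *ᵥ y) := by
    have h0 (v : Fin n → ℝ) : 0 ≤ v ⬝ᵥ (Q⁻¹ *ᵥ v) := by
      simpa using hQ.inv.posSemidef.dotProduct_mulVec_nonneg v
    rcases hxy with h | h
    · have : 0 < x ⬝ᵥ (Q⁻¹ *ᵥ x) := by simpa using hQ.inv.dotProduct_mulVec_pos h
      linarith [h0 y]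
    · have : 0 < y ⬝ᵥ (Q⁻¹ *ᵥ y) := by simpa using hQ.inv.dotProduct_mulVec_pos h
      linarith [h0 x]
  have hblock (u v : Fin n → ℝ) (huv : u ≠ 0 ∨ v ≠ 0) := by
    have h : Sum.elim u v ≠ 0 := by
      contrapose! huv
      exact ⟨funext fun i => congrFun huv (.inl i), funext fun i => congrFun huv (.inr i)⟩
    have := hB.dotProduct_mulVec_pos h
    rwa [star_trivial, sumElim_dotProduct_fromBlocks_mulVec] at this
  have h₁ := hblock x y hxy
  have h₂ := hblock y x hxy.symm
  have e₁ := congrArg (x ⬝ᵥ ·) hre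
  have e₂ := congrArg (y ⬝ᵥ ·) hre
  have e₃ := congrArg (x ⬝ᵥ ·) him
  have e₄ := congrArg (y ⬝ᵥ ·) him
  simp only [smul_mulVec, add_mulVec, dotProduct_smul, dotProduct_add, dotProduct_sub,
    smul_eq_mul, hJself, hsymm, hRsymm] at h₁ h₂ e₁ e₂ e₃ e₄
  set q := x ⬝ᵥ (Q⁻¹ *ᵥ x) + y ⬝ᵥ (Q⁻¹ *ᵥ y) with hqdef
  have hRq : x ⬝ᵥ (R *ᵥ x) + y ⬝ᵥ (R *ᵥ y) = -z.re * q := by rw [hqdef]; linarith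
  have hJq : y ⬝ᵥ (J *ᵥ x) - x ⬝ᵥ (J *ᵥ y) = -z.im * q := by rw [hqdef]; linarith
  have k₁ : 0 < q * ((a - z.re) * s - z.im * c) := by
    linear_combination h₁ + s * hRq + c * hJq - s * a * hqdef
  have k₂ : 0 < q * ((a - z.re) * s + z.im * c) := by
    linear_combination h₂ + s * hRq - c * hJq - s * a * hqdef
  have k₁' := (mul_pos_iff_of_pos_left hq).1 k₁
  have k₂' := (mul_pos_iff_of_pos_left hq).1 k₂
  rcases abs_cases z.im with ⟨h, -⟩ | ⟨h, -⟩ <;> rw [h] <;> linarith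

/-- DH characterization of matrices with all eigenvalues in the left conic sector
`{x + iy : |y| cos θ < (a - x) sin θ}`. -/
theorem left_conic_sector_stable_iff_DH {n : ℕ} (a θ : ℝ)
    (hθ0 : 0 < θ) (hθ1 : θ ≤ Real.pi / 2)
    (A : Matrix (Fin n) (Fin n) ℝ) :
    (∀ z : ℂ, ((A.map Complex.ofReal).charpoly).IsRoot z →
      |z.im| * Real.cos θ < (a - z.re) * Real.sin θ)
    ↔ ∃ J R Q : Matrix (Fin n) (Fin n) ℝ, Jᵀ = -J ∧ Rᵀ = R ∧ Q.PosDef ∧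
        A = (J - R) * Q ∧
        (Matrix.fromBlocks
          (Real.sin θ • (a • Q⁻¹ + R)) (-(Real.cos θ) • J)
          (Real.cos θ • J) (Real.sin θ • (a • Q⁻¹ + R))).PosDef := by
  constructor
  · exact exists_DH_of_spectrum_mem_sector
      (Real.sin_nonneg_of_nonneg_of_le_pi hθ0.le (by linarith [Real.pi_pos])) (Real.sin_le_one θ)
      (Real.cos_nonneg_of_neg_pi_div_two_le_of_le (by linarith) hθ1) (Real.cos_le_one θ) A
  · rintro ⟨J, R, Q, hJ, hR, hQ, rfl, hB⟩ z hz
    exact mem_sector_of_DH hJ hR hQ hB hz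
end

section
/- Let a ∈ ℝ and θ ∈ (0, π/2], and let Ω be the right conic sector Ω = {x + iy ∈ ℂ : |y|·cos(θ) < (x − a)·sin(θ)}. A real n×n matrix A has all of its complex eigenvalues in Ω if and only if A = (J − R)Q for some real n×n matrices J, R, Q with Jᵀ = −J, Rᵀ = R, Q symmetric positive definite, and such that the real symmetric 2n×2n block matrix [[−sin(θ)(aQ⁻¹ + R), −cos(θ)J], [cos(θ)J, −sin(θ)(aQ⁻¹ + R)]] is positive definite. -/
open Matrix

section Lyapunov

open scoped ComplexOrder

theorem Matrix.isRoot_charpoly_iff_exists_mulVec {K ι : Type*} [Field K] [Fintype ι]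
    [DecidableEq ι] (M : Matrix ι ι K) (z : K) :
    M.charpoly.IsRoot z ↔ ∃ v, v ≠ 0 ∧ M *ᵥ v = z • v := by
  rw [Polynomial.IsRoot.def, Matrix.eval_charpoly, ← Matrix.exists_mulVec_eq_zero_iff]
  simp only [Matrix.sub_mulVec, Matrix.scalar_apply, sub_eq_zero]
  refine exists_congr fun v => and_congr_right fun _ => ?_
  rw [eq_comm, ← Matrix.smul_one_eq_diagonal, Matrix.smul_mulVec, Matrix.one_mulVec]

theorem Matrix.PosDef.fromBlocks_of_schur {m n : Type*} [Fintype m] [Fintype n] [DecidableEq n]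
    {𝕜 : Type*} [RCLike 𝕜]
    {A : Matrix m m 𝕜} {B : Matrix m n 𝕜} {D : Matrix n n 𝕜} (hD : D.PosDef)
    (hS : (A - B * D⁻¹ * Bᴴ).PosDef) : (Matrix.fromBlocks A B Bᴴ D).PosDef := by
  let _ := hD.isUnit.invertible
  refine .of_dotProduct_mulVec_pos ((IsHermitian.fromBlocks₂₂ _ _ hD.1).2 hS.1) fun x hx => ?_
  rw [dotProduct_mulVec, ← Sum.elim_comp_inl_inr x, schur_complement_eq₂₂ A B _ _ hD.1,
    ← dotProduct_mulVec, ← dotProduct_mulVec]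
  by_cases h : x ∘ Sum.inl = 0
  · have h' : x ∘ Sum.inr ≠ 0 := fun h' => hx <| by
      rw [← Sum.elim_comp_inl_inr x, h, h']; simp
    simpa [h] using hD.dotProduct_mulVec_pos h'
  · exact add_pos_of_nonneg_of_pos (hD.posSemidef.dotProduct_mulVec_nonneg _)
      (hS.dotProduct_mulVec_pos h)

/-- Simultaneous Lyapunov certificate for the rotated matrices `ω • B`, `ω ∈ W`. -/
def HasLyapunov {ι : Type*} [Fintype ι] (B : Matrix ι ι ℂ) (W : Finset ℂ) : Prop :=
  ∃ P : Matrix ι ι ℂ, P.PosDef ∧ ∀ ω ∈ W, (ω • (B * P) + (ω • (B * P))ᴴ).PosDef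

theorem HasLyapunov.reindex {ι κ : Type*} [Fintype ι] [Fintype κ] {B : Matrix ι ι ℂ}
    {W : Finset ℂ} (e : ι ≃ κ) (h : HasLyapunov (Matrix.reindex e e B) W) : HasLyapunov B W := by
  obtain ⟨P, hP, hW⟩ := h
  refine ⟨P.submatrix e e, hP.submatrix e.injective, fun ω hω => ?_⟩
  convert! (hW ω hω).submatrix e.injective using 1
  have : B * P.submatrix e e = (Matrix.reindex e e B * P).submatrix e e := by
    rw [← Matrix.submatrix_mul_equiv _ _ _ e]; simp
  rw [this]
  ext i j
  simp

theorem HasLyapunov.conj {ι : Type*} [Fintype ι] [DecidableEq ι] {B : Matrix ι ι ℂ}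
    {W : Finset ℂ} (S : (Matrix ι ι ℂ)ˣ) (h : HasLyapunov (S⁻¹.val * B * S.val) W) :
    HasLyapunov B W := by
  obtain ⟨P, hP, hW⟩ := h
  have hS := vecMul_injective_of_isUnit S.isUnit
  refine ⟨S.val * P * S.valᴴ, hP.mul_mul_conjTranspose_same hS, fun ω hω => ?_⟩
  convert! (hW ω hω).mul_mul_conjTranspose_same hS using 1
  have : B * (S.val * P * S.valᴴ) = S.val * (S⁻¹.val * B * S.val * P) * S.valᴴ := by
    simp [← Matrix.mul_assoc]
  rw [this]
  simp only [Matrix.conjTranspose_smul, Matrix.conjTranspose_mul, Matrix.mul_add, Matrix.add_mul,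
    Matrix.mul_smul, Matrix.smul_mul, Matrix.mul_assoc, Matrix.conjTranspose_conjTranspose]

theorem HasLyapunov.fromBlocks {m : Type*} [Fintype m] [DecidableEq m] {W : Finset ℂ} (l : ℂ)
    (b : Matrix Unit m ℂ) {B : Matrix m m ℂ} (h : HasLyapunov B W)
    (hl : ∀ ω ∈ W, 0 < (ω * l).re) :
    HasLyapunov (Matrix.fromBlocks (l • (1 : Matrix Unit Unit ℂ)) b 0 B) W := by
  obtain ⟨P, hP, hW⟩ := h
  let c : ℂ → ℝ := fun ω =>
    ((ω • (b * P)) * (ω • (B * P) + (ω • (B * P))ᴴ)⁻¹ * (ω • (b * P))ᴴ) () () |>.re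
  obtain ⟨t, ht0, ht⟩ : ∃ t : ℝ, 0 < t ∧ ∀ ω ∈ W, c ω < 2 * (ω * l).re * t := by
    have : ∀ᶠ t : ℝ in Filter.atTop, 0 < t ∧ ∀ ω ∈ W, c ω < 2 * (ω * l).re * t := by
      refine (Filter.eventually_gt_atTop 0).and ((Filter.eventually_all_finset W).2 fun ω hω => ?_)
      exact (Filter.tendsto_id.const_mul_atTop (by linarith [hl ω hω])).eventually_gt_atTop _
    exact this.exists
  refine ⟨Matrix.fromBlocks ((t : ℂ) • 1) 0 0 P, ?_, fun ω hω => ?_⟩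
  · have := PosDef.fromBlocks_of_schur (A := (t : ℂ) • (1 : Matrix Unit Unit ℂ)) (B := 0) hP
      (by simpa only [Matrix.zero_mul, sub_zero] using
        Matrix.PosDef.one.smul (by exact_mod_cast ht0 : (0 : ℂ) < t))
    simpa using this
  · have key := PosDef.fromBlocks_of_schur (B := ω • (b * P))
      (A := ((2 * (ω * l).re * t : ℝ) : ℂ) • (1 : Matrix Unit Unit ℂ)) (hW ω hω) ?_
    · convert! key using 1
      simp only [Matrix.fromBlocks_multiply, Matrix.fromBlocks_smul,
        Matrix.fromBlocks_conjTranspose, Matrix.fromBlocks_add]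
      congr 1 
      · ext i j
        simp only [Complex.ext_iff]
        constructor <;> simp <;> ring
      · simp
      · simp
      · simp
    · have hH : ((ω • (b * P)) * (ω • (B * P) + (ω • (B * P))ᴴ)⁻¹ * (ω • (b * P))ᴴ).IsHermitian :=
        isHermitian_mul_mul_conjTranspose _ (hW ω hω).inv.1
      have hc : (ω • (b * P)) * (ω • (B * P) + (ω • (B * P))ᴴ)⁻¹ * (ω • (b * P))ᴴ =
          ((c ω : ℝ) : ℂ) • (1 : Matrix Unit Unit ℂ) := by
        ext i j
        rw [Matrix.smul_apply, Matrix.one_apply_eq, smul_eq_mul, mul_one]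
        exact (hH.coe_re_apply_self ()).symm
      rw [hc, ← sub_smul]
      refine Matrix.PosDef.one.smul ?_
      have := ht ω hω
      rw [← Complex.ofReal_sub]
      exact_mod_cast sub_pos.2 this

theorem hasLyapunov_of_isRoot_charpoly {n : ℕ} (B : Matrix (Fin n) (Fin n) ℂ) (W : Finset ℂ)
    (h : ∀ ω ∈ W, ∀ z, B.charpoly.IsRoot z → 0 < (ω * z).re) : HasLyapunov B W := by
  induction n with
  | zero => exact ⟨1, .one, fun ω _ => .of_dotProduct_mulVec_pos (Subsingleton.elim _ _)
      fun x hx => (hx (Subsingleton.elim _ _)).elim⟩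
  | succ n ih =>
    let e : Fin (n + 1) ≃ Unit ⊕ Fin n := Fintype.equivOfCardEq (by simp [add_comm])
    refine HasLyapunov.reindex e ?_
    rw [← Matrix.charpoly_reindex e] at h
    generalize Matrix.reindex e e B = C at h ⊢
    obtain ⟨l, hl⟩ := Complex.exists_root (f := C.charpoly)
      (by rw [Matrix.charpoly_degree_eq_dim]; simp; positivity)
    obtain ⟨v, hv, hCv⟩ := (isRoot_charpoly_iff_exists_mulVec C l).1 hl
    obtain ⟨T, hT⟩ := SeparatingDual.exists_continuousLinearEquiv_apply_eq (R := ℂ)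
      (x := (Pi.single (Sum.inl ()) 1 : Unit ⊕ Fin n → ℂ)) (by simp) hv
    obtain ⟨S, hS⟩ : ∃ S : (Matrix (Unit ⊕ Fin n) (Unit ⊕ Fin n) ℂ)ˣ,
        S.val *ᵥ Pi.single (Sum.inl ()) 1 = v := by
      refine ⟨⟨T.toLinearEquiv.toLinearMap.toMatrix', T.symm.toLinearEquiv.toLinearMap.toMatrix',
        ?_, ?_⟩, ?_⟩
      · rw [← LinearMap.toMatrix'_comp, ← LinearMap.toMatrix'_id]
        congr 1; ext; simp
      · rw [← LinearMap.toMatrix'_comp, ← LinearMap.toMatrix'_id]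
        congr 1; ext; simp
      · rw [LinearMap.toMatrix'_mulVec]; exact hT
    refine HasLyapunov.conj S ?_
    rw [← Matrix.charpoly_units_conj' S] at h
    have hcol : (S⁻¹.val * C * S.val) *ᵥ Pi.single (Sum.inl ()) 1 =
        l • Pi.single (Sum.inl ()) 1 := by
      rw [← Matrix.mulVec_mulVec, hS, ← Matrix.mulVec_mulVec, hCv, Matrix.mulVec_smul, ← hS,
        Matrix.mulVec_mulVec, Units.inv_mul, Matrix.one_mulVec]
    rw [Matrix.coe_units_inv] at hcol ⊢
    generalize (S.val)⁻¹ * C * S.val = N at h hcol ⊢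
    have hN : N = Matrix.fromBlocks (l • (1 : Matrix Unit Unit ℂ)) N.toBlocks₁₂ 0 N.toBlocks₂₂ := by
      rw [Matrix.mulVec_single_one] at hcol
      conv_lhs => rw [← Matrix.fromBlocks_toBlocks N]
      congr 1
      · ext i j
        simpa [Matrix.toBlocks₁₁] using congrFun hcol (Sum.inl ())
      · ext i j
        simpa [Matrix.toBlocks₂₁] using congrFun hcol (Sum.inr i)
    rw [hN] at h ⊢
    rw [Matrix.charpoly_fromBlocks_zero₂₁] at h
    refine HasLyapunov.fromBlocks l _ (ih _ fun ω hω z hz => ?_) fun ω hω => ?_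
    · exact h ω hω z (Polynomial.root_mul_left_of_isRoot _ hz)
    · refine h ω hω l (Polynomial.root_mul_right_of_isRoot _ ?_)
      exact (isRoot_charpoly_iff_exists_mulVec _ _).2 ⟨1, one_ne_zero, by
        rw [Matrix.smul_mulVec, Matrix.one_mulVec]⟩

theorem posDef_fromBlocks_iff_complex {ι : Type*} [Fintype ι] (X Y : Matrix ι ι ℝ) :
    (Matrix.fromBlocks X (-Y) Y X).PosDef ↔
      (X.map Complex.ofReal + Complex.I • Y.map Complex.ofReal).PosDef := by
  have hherm : (Matrix.fromBlocks X (-Y) Y X).IsHermitian ↔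
      (X.map Complex.ofReal + Complex.I • Y.map Complex.ofReal).IsHermitian := by
    simp only [Matrix.IsHermitian, ← Matrix.ext_iff, Sum.forall]
    simp [Complex.ext_iff, forall_and]
    grind
  have hmul (x y : ι → ℝ) (i : ι) :
      ((X.map Complex.ofReal + Complex.I • Y.map Complex.ofReal) *ᵥ
        fun i => (⟨x i, y i⟩ : ℂ)) i = ⟨(X *ᵥ x - Y *ᵥ y) i, (Y *ᵥ x + X *ᵥ y) i⟩ := by
    apply Complex.ext <;>
    simp only [dotProduct, Matrix.mulVec, Pi.add_apply, Pi.sub_apply, Complex.re_sum,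
      Complex.im_sum, ← Finset.sum_add_distrib, ← Finset.sum_sub_distrib] <;>
    refine Finset.sum_congr rfl fun j _ => ?_
    · simp [sub_eq_add_neg]
    · simp [add_comm]
  have hre (x y : ι → ℝ) :
      (star (fun i => (⟨x i, y i⟩ : ℂ)) ⬝ᵥ
        ((X.map Complex.ofReal + Complex.I • Y.map Complex.ofReal) *ᵥ
          fun i => (⟨x i, y i⟩ : ℂ))).re =
      star (Sum.elim x y) ⬝ᵥ (Matrix.fromBlocks X (-Y) Y X *ᵥ Sum.elim x y) := by
    rw [dotProduct, Complex.re_sum, Matrix.fromBlocks_mulVec, dotProduct, Fintype.sum_sum_type,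
      ← Finset.sum_add_distrib]
    refine Finset.sum_congr rfl fun i _ => ?_
    rw [hmul]
    simp [Matrix.neg_mulVec, sub_eq_add_neg]
  rw [posDef_iff_dotProduct_mulVec, posDef_iff_dotProduct_mulVec, hherm]
  refine and_congr_right fun hH => ⟨fun h z hz => ?_, fun h w hw => ?_⟩
  · have h1 := h (x := Sum.elim (fun i => (z i).re) fun i => (z i).im) fun h0 => hz <| by
      ext i
      exact Complex.ext (congrFun h0 (Sum.inl i)) (congrFun h0 (Sum.inr i))
    rw [← hre] at h1
    exact Complex.pos_iff.2 ⟨h1, (hH.im_star_dotProduct_mulVec_self z).symm⟩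
  · have h1 := h (x := fun i => ⟨w (Sum.inl i), w (Sum.inr i)⟩) fun h0 => hw <| by
      ext (i | i)
      · exact congrArg Complex.re (congrFun h0 i)
      · exact congrArg Complex.im (congrFun h0 i)
    have h2 := (Complex.pos_iff.1 h1).1
    rw [hre fun i => w (Sum.inl i)] at h2
    rwa [← Sum.elim_comp_inl_inr w]

theorem Matrix.posDef_map_ofReal_iff {ι : Type*} [Fintype ι] [DecidableEq ι]
    (M : Matrix ι ι ℝ) : (M.map Complex.ofReal).PosDef ↔ M.PosDef := by
  have h0 : M.map Complex.ofReal =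
      M.map Complex.ofReal + Complex.I • (0 : Matrix ι ι ℝ).map Complex.ofReal := by
    ext; simp
  rw [h0, ← posDef_fromBlocks_iff_complex]
  refine ⟨fun h => ?_, fun h => ?_⟩
  · convert! h.submatrix (e := Sum.inl) Sum.inl_injective using 1
  · simpa using PosDef.fromBlocks_of_schur (B := 0) h (by simpa using h)

theorem mem_sector_of_posDef_fromBlocks {ι : Type*} [Fintype ι] [DecidableEq ι]
    {s c a : ℝ} {A J S Q : Matrix ι ι ℝ} (hJ : Jᵀ = -J) (hS : Sᵀ = S) (hQ : Q.PosDef)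
    (hA : A - a • (1 : Matrix ι ι ℝ) = (J + S) * Q)
    (hK : (Matrix.fromBlocks (s • S) (-(c • J)) (c • J) (s • S)).PosDef)
    {z : ℂ} (hz : (A.map Complex.ofReal).charpoly.IsRoot z) :
    |z.im| * c < (z.re - a) * s := by
  obtain ⟨v, hv, hAv⟩ := (isRoot_charpoly_iff_exists_mulVec _ z).1 hz
  rw [posDef_fromBlocks_iff_complex] at hK
  rw [← Matrix.posDef_map_ofReal_iff] at hQ
  have hA' : A.map Complex.ofReal - (a : ℂ) • (1 : Matrix ι ι ℂ) =
      (J.map Complex.ofReal + S.map Complex.ofReal) * Q.map Complex.ofReal := by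
    have := congrArg (fun M : Matrix ι ι ℝ => M.map Complex.ofRealHom) hA
    simp only [Matrix.map_mul] at this
    convert! this using 1
    · ext i j
      by_cases h : i = j <;> simp [h]
    · congr 1
      ext; simp
  have hsJ : (s • S).map Complex.ofReal = (s : ℂ) • S.map Complex.ofReal := by ext; simp
  have hcJ : (c • J).map Complex.ofReal = (c : ℂ) • J.map Complex.ofReal := by ext; simp
  rw [hsJ, hcJ] at hK
  have hJ' : (J.map Complex.ofReal)ᵀ = -J.map Complex.ofReal := by
    rw [← Matrix.transpose_map, hJ]; ext; simp
  have hS' : (S.map Complex.ofReal).IsHermitian := by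
    ext i j; simpa using congrFun (congrFun hS i) j
  have hIJ : (Complex.I • J.map Complex.ofReal).IsHermitian := by
    ext i j
    have : J j i = -J i j := congrFun (congrFun hJ i) j
    simp [this]
  have hKt := hK.transpose
  rw [Matrix.transpose_add, Matrix.transpose_smul, Matrix.transpose_smul, Matrix.transpose_smul,
    hJ', ← Matrix.transpose_map, hS] at hKt
  set J' := J.map Complex.ofReal
  set S' := S.map Complex.ofReal
  set Q' := Q.map Complex.ofReal
  have hu : Q' *ᵥ v ≠ 0 := fun h => hv <|
    mulVec_injective_of_isUnit hQ.isUnit (by rw [h, Matrix.mulVec_zero])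
  have hq := hQ.dotProduct_mulVec_pos hv
  have hsum : star (Q' *ᵥ v) ⬝ᵥ (J' *ᵥ (Q' *ᵥ v)) + star (Q' *ᵥ v) ⬝ᵥ (S' *ᵥ (Q' *ᵥ v)) =
      (z - a) * (star v ⬝ᵥ (Q' *ᵥ v)) := by
    rw [← dotProduct_add, ← Matrix.add_mulVec, Matrix.mulVec_mulVec, ← hA', Matrix.sub_mulVec,
      hAv, Matrix.smul_mulVec, Matrix.one_mulVec, ← sub_smul, dotProduct_smul, Matrix.star_mulVec,
      hQ.1.eq, ← Matrix.dotProduct_mulVec, smul_eq_mul]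
  have h1 := hK.dotProduct_mulVec_pos hu
  have h2 := hKt.dotProduct_mulVec_pos hu
  have h3 := hS'.im_star_dotProduct_mulVec_self (Q' *ᵥ v)
  have h4 := hIJ.im_star_dotProduct_mulVec_self (Q' *ᵥ v)
  generalize Q' *ᵥ v = u at *
  simp only [Matrix.add_mulVec, Matrix.smul_mulVec, Matrix.neg_mulVec, dotProduct_add,
    dotProduct_smul, dotProduct_neg, smul_neg] at h1 h2 h3 h4
  generalize star u ⬝ᵥ (J' *ᵥ u) = j at *
  generalize star u ⬝ᵥ (S' *ᵥ u) = p at *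
  generalize star v ⬝ᵥ u = q at *
  obtain ⟨hq1, hq2⟩ := Complex.pos_iff.1 hq
  have h1' := (Complex.pos_iff.1 h1).1
  have h2' := (Complex.pos_iff.1 h2).1
  have hre := congrArg Complex.re hsum
  have him := congrArg Complex.im hsum
  simp at h1' h2' h3 h4 hre him
  rw [← hq2] at hre him
  rw [h4] at hre
  rw [h3] at him
  simp at hre him
  rw [hre, him] at h1' h2'
  rcases abs_cases z.im with ⟨h, -⟩ | ⟨h, -⟩ <;> rw [h] <;>
    refine lt_of_mul_lt_mul_right ?_ hq1.le <;> linarith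

theorem exists_posDef_fromBlocks_of_sector {n : ℕ} {s c : ℝ} (hc : 0 ≤ c)
    (B : Matrix (Fin n) (Fin n) ℝ)
    (hB : ∀ z, (B.map Complex.ofReal).charpoly.IsRoot z → |z.im| * c < z.re * s) :
    ∃ J S P : Matrix (Fin n) (Fin n) ℝ, Jᵀ = -J ∧ Sᵀ = S ∧ P.PosDef ∧ J + S = B * P ∧
      (Matrix.fromBlocks (s • S) (-(c • J)) (c • J) (s • S)).PosDef := by
  obtain ⟨C, hC, hW⟩ := hasLyapunov_of_isRoot_charpoly (B.map Complex.ofReal) {⟨s, c⟩, ⟨s, -c⟩} <| by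
    intro ω hω z hz
    have h1 := hB z hz
    have h2 := mul_le_mul_of_nonneg_right (le_abs_self z.im) hc
    have h3 := mul_le_mul_of_nonneg_right (neg_abs_le z.im) hc
    simp only [Finset.mem_insert, Finset.mem_singleton] at hω
    rcases hω with rfl | rfl <;> simp <;> linarith
  have hW1 := hW ⟨s, c⟩ (by simp)
  have hW2 := (hW ⟨s, -c⟩ (by simp)).transpose
  set P : Matrix (Fin n) (Fin n) ℝ := C.map Complex.re
  have hCP : P.map Complex.ofReal = (1 / 2 : ℝ) • (C + Cᵀ) := by
    ext i j
    have := congrFun (congrFun hC.1.eq i) j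
    simp only [Matrix.conjTranspose_apply, Complex.ext_iff] at this
    apply Complex.ext <;> simp [P] at this ⊢ <;> linarith
  have hP : P.PosDef := by
    rw [← Matrix.posDef_map_ofReal_iff, hCP]
    exact (hC.add hC.transpose).smul (by norm_num)
  have hPt : Pᵀ = P := by simpa using hP.1.eq
  refine ⟨(1 / 2 : ℝ) • (B * P - P * Bᵀ), (1 / 2 : ℝ) • (B * P + P * Bᵀ), P, ?_, ?_, hP, ?_, ?_⟩
  · simp only [Matrix.transpose_smul, Matrix.transpose_sub, Matrix.transpose_mul,
      Matrix.transpose_transpose, hPt]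
    module
  · simp only [Matrix.transpose_smul, Matrix.transpose_add, Matrix.transpose_mul,
      Matrix.transpose_transpose, hPt]
    module
  · module
  · rw [posDef_fromBlocks_iff_complex]
    convert! (hW1.add hW2).smul (by norm_num : (0 : ℝ) < 1 / 4) using 1
    have hBt : (B.map Complex.ofReal)ᴴ = (B.map Complex.ofReal)ᵀ := by ext; simp
    have hBP : (B * P).map Complex.ofReal = B.map Complex.ofReal * P.map Complex.ofReal :=
      Matrix.map_mul (f := Complex.ofRealHom)
    have hPB : (P * Bᵀ).map Complex.ofReal = P.map Complex.ofReal * (B.map Complex.ofReal)ᵀ :=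
      Matrix.map_mul (f := Complex.ofRealHom)
    have hs : star (⟨s, c⟩ : ℂ) = ⟨s, -c⟩ := rfl
    have hs' : star (⟨s, -c⟩ : ℂ) = ⟨s, c⟩ := by simp [Complex.ext_iff]
    trans (1 / 2 : ℝ) • ((⟨s, c⟩ : ℂ) • (B * P).map Complex.ofReal +
      (⟨s, -c⟩ : ℂ) • (P * Bᵀ).map Complex.ofReal)
    · ext i j
      apply Complex.ext <;> simp <;> ring
    · rw [hBP, hPB, hCP]
      simp only [Matrix.conjTranspose_smul, Matrix.conjTranspose_mul, hC.1.eq, hBt,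
        Matrix.transpose_add, Matrix.transpose_smul, Matrix.transpose_mul, hs, hs',
        Matrix.transpose_transpose, Matrix.mul_smul, Matrix.smul_mul, Matrix.mul_add,
        Matrix.add_mul]
      module

end Lyapunov

/-- DH characterization of matrices with all eigenvalues in the right conic sector
`{x + iy : |y| cos θ < (x - a) sin θ}`. -/
theorem right_conic_sector_stable_iff_DH {n : ℕ} (a θ : ℝ)
    (hθ0 : 0 < θ) (hθ1 : θ ≤ Real.pi / 2)
    (A : Matrix (Fin n) (Fin n) ℝ) :
    (∀ z : ℂ, ((A.map Complex.ofReal).charpoly).IsRoot z →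
      |z.im| * Real.cos θ < (z.re - a) * Real.sin θ)
    ↔ ∃ J R Q : Matrix (Fin n) (Fin n) ℝ, Jᵀ = -J ∧ Rᵀ = R ∧ Q.PosDef ∧
        A = (J - R) * Q ∧
        (Matrix.fromBlocks
          (-(Real.sin θ) • (a • Q⁻¹ + R)) (-(Real.cos θ) • J)
          (Real.cos θ • J) (-(Real.sin θ) • (a • Q⁻¹ + R))).PosDef := by
  constructor
  · intro h
    have hcos : 0 ≤ Real.cos θ := Real.cos_nonneg_of_neg_pi_div_two_le_of_le (by linarith) hθ1
    obtain ⟨J, S, P, hJ, hS, hP, hBP, hK⟩ := exists_posDef_fromBlocks_of_sector hcos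
      (s := Real.sin θ) (A - a • (1 : Matrix (Fin n) (Fin n) ℝ)) fun z hz => by
        obtain ⟨v, hv, hvz⟩ := (isRoot_charpoly_iff_exists_mulVec _ z).1 hz
        have := h (z + a) <| (isRoot_charpoly_iff_exists_mulVec _ _).2 ⟨v, hv, by
          have hA : A.map Complex.ofReal = (A - a • (1 : Matrix (Fin n) (Fin n) ℝ)).map
              Complex.ofReal + (a : ℂ) • (1 : Matrix (Fin n) (Fin n) ℂ) := by
            ext i j
            by_cases hij : i = j <;> simp [hij]
          rw [hA, Matrix.add_mulVec, hvz, Matrix.smul_mulVec, Matrix.one_mulVec, add_smul]⟩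
        simpa using this
    have hPu := (Matrix.isUnit_iff_isUnit_det _).1 hP.isUnit
    have hPt : Pᵀ = P := by simpa using hP.1.eq
    have hR : -Real.sin θ • (a • P + (-S - a • P)) = Real.sin θ • S := by module
    refine ⟨J, -S - a • P, P⁻¹, hJ, by simp [hS, hPt], hP.inv, ?_, ?_⟩
    · have : J - (-S - a • P) = A * P := by
        rw [show J - (-S - a • P) = J + S + a • P by module, hBP]
        simp [Matrix.sub_mul]
      rw [this, Matrix.mul_nonsing_inv_cancel_right _ _ hPu]
    · rwa [Matrix.nonsing_inv_nonsing_inv _ hPu, hR, neg_smul]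
  · rintro ⟨J, R, Q, hJ, hR, hQ, hA, hK⟩ z hz
    have hQu := (Matrix.isUnit_iff_isUnit_det _).1 hQ.isUnit
    have hQt : (Q⁻¹)ᵀ = Q⁻¹ := by simpa using hQ.inv.1.eq
    refine mem_sector_of_posDef_fromBlocks (S := -(a • Q⁻¹ + R)) hJ (by simp [hR, hQt]) hQ
      ?_ ?_ hz
    · rw [hA, show J + -(a • Q⁻¹ + R) = J - R - a • Q⁻¹ by module, Matrix.sub_mul _ (a • Q⁻¹)]
      simp [Matrix.nonsing_inv_mul _ hQu]
    · simpa only [neg_smul, smul_neg] using hK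
end

section
/- Let h, k ∈ ℝ with h < k, and let Ω be the vertical strip Ω = {z ∈ ℂ : h < Re(z) < k}. A real n×n matrix A has all of its complex eigenvalues in Ω if and only if A = (J − R)Q for some real n×n matrices J, R, Q with Jᵀ = −J, Rᵀ = R, Q symmetric positive definite, and such that the real symmetric 2n×2n block-diagonal matrix [[kQ⁻¹ + R, 0], [0, −hQ⁻¹ − R]] is positive definite. -/
open Matrix

/-- If every `T - μ` with `Re μ` outside `(h, k)` is surjective, then the real part of the quadratic
form of `T` lies strictly between `h` and `k` for a suitable inner product, with a uniform gap. -/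
theorem exists_adapted_inner {h k : ℝ} (d : ℕ) :
    ∀ (V : Type) [AddCommGroup V] [Module ℂ V] [FiniteDimensional ℂ V] (T : V →ₗ[ℂ] V),
      Module.finrank ℂ V = d →
      (∀ μ : ℂ, ¬ (h < μ.re ∧ μ.re < k) → Function.Surjective fun x => T x - μ • x) →
      ∃ (E : Type) (_ : NormedAddCommGroup E) (_ : InnerProductSpace ℂ E)
        (_ : FiniteDimensional ℂ E) (S : V →ₗ[ℂ] E) (δ : ℝ),
        Function.Injective S ∧ 0 < δ ∧ ∀ x,
          (h + δ) * ‖S x‖ ^ 2 ≤ (inner ℂ (S x) (S (T x))).re ∧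
          (inner ℂ (S x) (S (T x))).re ≤ (k - δ) * ‖S x‖ ^ 2 := by
  induction d with
  | zero =>
    intro V _ _ _ T hV _
    have := Module.finrank_zero_iff.mp hV
    refine ⟨ℂ, inferInstance, inferInstance, inferInstance, 0, 1,
      Function.injective_of_subsingleton _, one_pos, by simp⟩
  | succ d ih =>
    intro V _ _ _ T hV hT
    have : Nontrivial V := Module.nontrivial_of_finrank_pos (R := ℂ) (by omega)
    obtain ⟨l, hl⟩ := Module.End.exists_eigenvalue (K := ℂ) T
    obtain ⟨v, hv⟩ := hl.exists_hasEigenvector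
    have hTv : T v = l • v := hv.apply_eq_smul
    have hv0 : v ≠ 0 := hv.2
    have hlΩ : h < l.re ∧ l.re < k := by
      by_contra hcon
      have hs : Function.Surjective (T - l • LinearMap.id : V →ₗ[ℂ] V) := hT l hcon
      refine hv0 ((LinearMap.injective_iff_surjective.mpr hs) ?_)
      simp [hTv]
    obtain ⟨f, hf⟩ := Module.Projective.exists_dual_eq_one ℂ hv0
    let p : Submodule ℂ V := Submodule.span ℂ {v}
    have hp : p ≤ p.comap T := by
      rw [Submodule.span_le]
      rintro _ rfl
      simpa [hTv] using p.smul_mem l (Submodule.mem_span_singleton_self _)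
    obtain ⟨E, _, _, _, L, δ, hL, hδ, hE⟩ := ih (V ⧸ p) (p.mapQ p T hp)
      (by
        have h1 := Submodule.finrank_quotient_add_finrank p
        have h2 : Module.finrank ℂ p = 1 := finrank_span_singleton hv0
        omega)
      (by
        intro μ hμ y
        obtain ⟨y, rfl⟩ := p.mkQ_surjective y
        obtain ⟨x, rfl⟩ := hT μ hμ y
        exact ⟨p.mkQ x, by simp⟩)
    let g : V →ₗ[ℂ] ℂ := f ∘ₗ T - l • f
    have hg : p ≤ LinearMap.ker g := by
      rw [Submodule.span_le]
      rintro _ rfl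
      simp [g, hTv]
    obtain ⟨P, hP⟩ := L.exists_leftInverse_of_injective (LinearMap.ker_eq_bot.mpr hL)
    let G : E →L[ℂ] ℂ := (p.liftQ g hg ∘ₗ P).toContinuousLinearMap
    have hG (x : V) : ‖g x‖ ≤ ‖G‖ * ‖L (p.mkQ x)‖ := by
      have h1 : G (L (p.mkQ x)) = g x := by
        have h2 : P (L (p.mkQ x)) = p.mkQ x := LinearMap.congr_fun hP _
        change p.liftQ g hg (P (L (p.mkQ x))) = g x
        rw [h2]
        simp
      rw [← h1]
      exact G.le_opNorm _
    let ε := min δ (min (k - l.re) (l.re - h))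
    have hε : 0 < ε := lt_min hδ (lt_min (by linarith [hlΩ.2]) (by linarith [hlΩ.1]))
    have hε1 : ε ≤ δ := min_le_left _ _
    have hε2 : ε ≤ k - l.re := (min_le_right _ _).trans (min_le_left _ _)
    have hε3 : ε ≤ l.re - h := (min_le_right _ _).trans (min_le_right _ _)
    obtain ⟨c, hc, hcG⟩ := exists_pos_mul_lt hε ‖G‖
    let S : V →ₗ[ℂ] WithLp 2 (ℂ × E) :=
      (WithLp.linearEquiv 2 ℂ (ℂ × E)).symm.toLinearMap ∘ₗ
        (((c : ℂ) • f).prod (L ∘ₗ p.mkQ))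
    have hS (x : V) : S x = WithLp.toLp 2 ((c : ℂ) * f x, L (p.mkQ x)) := rfl
    refine ⟨WithLp 2 (ℂ × E), inferInstance, inferInstance, inferInstance, S, ε / 2, ?_,
      by positivity, ?_⟩
    · rw [← LinearMap.ker_eq_bot, LinearMap.ker_eq_bot']
      intro x hx
      rw [hS] at hx
      have hx' : ((c : ℂ) * f x, L (p.mkQ x)) = 0 := by simpa using hx
      obtain ⟨h1, h2⟩ := Prod.mk_eq_zero.mp hx'
      have h3 : p.mkQ x = 0 := hL (by rw [h2, map_zero])
      rw [Submodule.mkQ_apply, Submodule.Quotient.mk_eq_zero, Submodule.mem_span_singleton] at h3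
      obtain ⟨a, rfl⟩ := h3
      have : a = 0 := by simpa [hf, hc.ne'] using h1
      simp [this]
    · intro x
      have hTx : f (T x) = l * f x + g x := by simp [g]
      set t := c * ‖f x‖ with ht
      set N := ‖L (p.mkQ x)‖ with hN
      have hnorm : ‖S x‖ ^ 2 = t ^ 2 + N ^ 2 := by
        rw [hS, WithLp.prod_norm_sq_eq_of_L2]
        simp [ht, abs_of_pos hc, hN]
      have hinner : (inner ℂ (S x) (S (T x))).re =
          l.re * t ^ 2 + c ^ 2 * (g x * (starRingEnd ℂ) (f x)).re +
            (inner ℂ (L (p.mkQ x)) (L (p.mapQ p T hp (p.mkQ x)))).re := by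
        rw [hS, hS, WithLp.prod_inner_apply, Complex.add_re, hTx]
        congr 1
        simp only [RCLike.inner_apply, ht, mul_pow, ← Complex.normSq_eq_norm_sq,
          Complex.normSq_apply, map_mul, Complex.conj_ofReal, Complex.mul_re, Complex.mul_im,
          Complex.add_re, Complex.add_im, Complex.ofReal_re, Complex.ofReal_im, Complex.conj_re,
          Complex.conj_im]
        ring
      have hcross : |c ^ 2 * (g x * (starRingEnd ℂ) (f x)).re| ≤ ε * (t * N) := by
        rw [abs_mul, abs_of_pos (pow_pos hc 2)]
        calc c ^ 2 * |(g x * (starRingEnd ℂ) (f x)).re| ≤ c ^ 2 * (‖g x‖ * ‖f x‖) := by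
              gcongr
              simpa using Complex.abs_re_le_norm (g x * (starRingEnd ℂ) (f x))
          _ ≤ c ^ 2 * (‖G‖ * N * ‖f x‖) := by gcongr; exact hG x
          _ = (‖G‖ * c) * (t * N) := by rw [ht]; ring
          _ ≤ ε * (t * N) := by gcongr
      have hE' := hE (p.mkQ x)
      rw [hnorm, hinner]
      rw [abs_le] at hcross
      have h1 : 0 ≤ ε * (t - N) ^ 2 := by positivity
      have h2 := mul_le_mul_of_nonneg_right hε1 (sq_nonneg N)
      have h3 := mul_le_mul_of_nonneg_right hε2 (sq_nonneg t)
      have h4 := mul_le_mul_of_nonneg_right hε3 (sq_nonneg t)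
      constructor <;> nlinarith [hE'.1, hE'.2, hcross.1, hcross.2]

theorem isRoot_charpoly_iff_exists_mulVec {n : ℕ} (A : Matrix (Fin n) (Fin n) ℂ) (z : ℂ) :
    A.charpoly.IsRoot z ↔ ∃ v ≠ 0, A *ᵥ v = z • v := by
  rw [← Matrix.charpoly_toLin', ← Module.End.hasEigenvalue_iff_isRoot_charpoly]
  constructor
  · intro hz
    obtain ⟨v, hv⟩ := hz.exists_hasEigenvector
    exact ⟨v, hv.2, by simpa using hv.apply_eq_smul⟩
  · rintro ⟨v, hv, h⟩
    exact Module.End.hasEigenvalue_of_hasEigenvector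
      (Module.End.hasEigenvector_iff.mpr ⟨Module.End.mem_eigenspace_iff.mpr (by simpa using h), hv⟩)

theorem exists_posDef_of_spectrum_in_strip {n : ℕ} {h k : ℝ} {A : Matrix (Fin n) (Fin n) ℝ}
    (hA : ∀ z : ℂ, ((A.map Complex.ofReal).charpoly).IsRoot z → h < z.re ∧ z.re < k) :
    ∃ Q : Matrix (Fin n) (Fin n) ℝ, Q.PosDef ∧ ∀ x ≠ 0,
      h * (x ⬝ᵥ Q *ᵥ x) < x ⬝ᵥ Q *ᵥ A *ᵥ x ∧ x ⬝ᵥ Q *ᵥ A *ᵥ x < k * (x ⬝ᵥ Q *ᵥ x) := by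
  obtain ⟨E, _, _, _, S, δ, hS, hδ, hE⟩ := exists_adapted_inner (h := h) (k := k) _ (Fin n → ℂ)
    (Matrix.toLin' (A.map Complex.ofReal)) rfl (by
      intro μ hμ
      let D : (Fin n → ℂ) →ₗ[ℂ] (Fin n → ℂ) :=
        Matrix.toLin' (A.map Complex.ofReal) - μ • LinearMap.id
      change Function.Surjective D
      rw [← LinearMap.injective_iff_surjective, ← LinearMap.ker_eq_bot, LinearMap.ker_eq_bot']
      intro v hv
      by_contra hv0
      exact hμ (hA μ ((isRoot_charpoly_iff_exists_mulVec _ _).mpr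
        ⟨v, hv0, by simpa [D, sub_eq_zero] using hv⟩)))
  let Q : Matrix (Fin n) (Fin n) ℝ :=
    Matrix.of fun i j => (inner ℂ (S (Pi.single i 1)) (S (Pi.single j 1))).re
  let ι : (Fin n → ℝ) → Fin n → ℂ := fun x i => (x i : ℂ)
  have hι (x : Fin n → ℝ) : S (ι x) = ∑ i, (x i : ℂ) • S (Pi.single i 1) := by
    rw [LinearMap.pi_apply_eq_sum_univ S (ι x)]
    refine Finset.sum_congr rfl fun i _ => ?_
    congr 2
    ext j
    simp [Pi.single_apply, eq_comm]
  have hQ (x y : Fin n → ℝ) : x ⬝ᵥ Q *ᵥ y = (inner ℂ (S (ι x)) (S (ι y))).re := by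
    rw [hι, hι, sum_inner, Complex.re_sum]
    refine Finset.sum_congr rfl fun i _ => ?_
    rw [inner_sum, Complex.re_sum, mulVec, dotProduct, Finset.mul_sum]
    refine Finset.sum_congr rfl fun j _ => ?_
    rw [inner_smul_left, inner_smul_right, Complex.conj_ofReal, Complex.re_ofReal_mul,
      Complex.re_ofReal_mul]
    simp only [Q, of_apply]
    ring
  have hQself (x : Fin n → ℝ) : x ⬝ᵥ Q *ᵥ x = ‖S (ι x)‖ ^ 2 := by
    rw [hQ, inner_self_eq_norm_sq_to_K]
    norm_cast
  have hpos (x : Fin n → ℝ) (hx : x ≠ 0) : 0 < ‖S (ι x)‖ ^ 2 := by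
    have : S (ι x) ≠ 0 := by
      rw [Ne, map_eq_zero_iff S hS]
      contrapose! hx
      ext i
      simpa [ι] using congrFun hx i
    positivity
  have hmul (x : Fin n → ℝ) : Matrix.toLin' (A.map Complex.ofReal) (ι x) = ι (A *ᵥ x) := by
    ext i
    simp [ι, mulVec, dotProduct]
  refine ⟨Q, .of_dotProduct_mulVec_pos ?_ fun x hx => ?_, fun x hx => ?_⟩
  · ext i j
    simp only [Q, conjTranspose_apply, of_apply, star_trivial]
    rw [← inner_conj_symm, Complex.conj_re]
  · rw [star_trivial, hQself]
    exact hpos x hx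
  · have h1 := hE (ι x)
    have h2 := mul_pos hδ (hpos x hx)
    rw [hmul] at h1
    rw [hQself, hQ]
    constructor <;> nlinarith [h1.1, h1.2]

theorem spectrum_in_strip_of_posDef {n : ℕ} {h k : ℝ} {A Q : Matrix (Fin n) (Fin n) ℝ}
    (hQ : Q.PosDef) (hAQ : ∀ x ≠ 0,
      h * (x ⬝ᵥ Q *ᵥ x) < x ⬝ᵥ Q *ᵥ A *ᵥ x ∧ x ⬝ᵥ Q *ᵥ A *ᵥ x < k * (x ⬝ᵥ Q *ᵥ x))
    (z : ℂ) (hz : ((A.map Complex.ofReal).charpoly).IsRoot z) : h < z.re ∧ z.re < k := by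
  obtain ⟨v, hv, hAv⟩ := (isRoot_charpoly_iff_exists_mulVec _ _).mp hz
  let x : Fin n → ℝ := fun i => (v i).re
  let y : Fin n → ℝ := fun i => (v i).im
  have hx : A *ᵥ x = z.re • x - z.im • y := by
    ext i
    simpa [mulVec, dotProduct, x, y] using congrArg Complex.re (congrFun hAv i)
  have hy : A *ᵥ y = z.re • y + z.im • x := by
    ext i
    simpa [mulVec, dotProduct, x, y] using congrArg Complex.im (congrFun hAv i)
  have hsymm : y ⬝ᵥ Q *ᵥ x = x ⬝ᵥ Q *ᵥ y := by
    have hT : Qᵀ = Q := by simpa using hQ.isHermitian.eq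
    rw [dotProduct_mulVec, ← mulVec_transpose, hT, dotProduct_comm]
  have hsum : x ⬝ᵥ Q *ᵥ A *ᵥ x + y ⬝ᵥ Q *ᵥ A *ᵥ y =
      z.re * (x ⬝ᵥ Q *ᵥ x + y ⬝ᵥ Q *ᵥ y) := by
    rw [hx, hy]
    simp only [mulVec_sub, mulVec_add, mulVec_smul, dotProduct_sub, dotProduct_add,
      dotProduct_smul, smul_eq_mul, hsymm]
    ring
  have hle (w : Fin n → ℝ) : 0 ≤ w ⬝ᵥ Q *ᵥ w ∧
      h * (w ⬝ᵥ Q *ᵥ w) ≤ w ⬝ᵥ Q *ᵥ A *ᵥ w ∧ w ⬝ᵥ Q *ᵥ A *ᵥ w ≤ k * (w ⬝ᵥ Q *ᵥ w) := by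
    rcases eq_or_ne w 0 with rfl | hw
    · simp
    · exact ⟨by simpa using (hQ.dotProduct_mulVec_pos hw).le, (hAQ w hw).1.le, (hAQ w hw).2.le⟩
  have hxy : x ≠ 0 ∨ y ≠ 0 := by
    by_contra! hcon
    exact hv (funext fun i => Complex.ext (congrFun hcon.1 i) (congrFun hcon.2 i))
  have hlt : h * (x ⬝ᵥ Q *ᵥ x + y ⬝ᵥ Q *ᵥ y) < z.re * (x ⬝ᵥ Q *ᵥ x + y ⬝ᵥ Q *ᵥ y) ∧
      z.re * (x ⬝ᵥ Q *ᵥ x + y ⬝ᵥ Q *ᵥ y) < k * (x ⬝ᵥ Q *ᵥ x + y ⬝ᵥ Q *ᵥ y) := by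
    rw [← hsum]
    obtain ⟨_, hx1, hx2⟩ := hle x
    obtain ⟨_, hy1, hy2⟩ := hle y
    rcases hxy with h0 | h0
    · obtain ⟨h1, h2⟩ := hAQ _ h0
      constructor <;> linarith
    · obtain ⟨h1, h2⟩ := hAQ _ h0
      constructor <;> linarith
  have hnonneg := add_nonneg (hle x).1 (hle y).1
  exact ⟨lt_of_mul_lt_mul_right hlt.1 hnonneg, lt_of_mul_lt_mul_right hlt.2 hnonneg⟩

theorem posDef_fromBlocks_zero_iff {m n : Type*} [Fintype m] [Fintype n]
    {B : Matrix m m ℝ} {D : Matrix n n ℝ} :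
    (fromBlocks B 0 0 D).PosDef ↔ B.PosDef ∧ D.PosDef := by
  constructor
  · intro hM
    exact ⟨hM.submatrix Sum.inl_injective, hM.submatrix Sum.inr_injective⟩
  · rintro ⟨hB, hD⟩
    refine .of_dotProduct_mulVec_pos (hB.isHermitian.fromBlocks (by simp) hD.isHermitian) ?_
    intro x hx
    obtain ⟨a, b, rfl⟩ : ∃ a b, x = Sum.elim a b := ⟨x ∘ Sum.inl, x ∘ Sum.inr, by simp⟩
    have ha := hB.posSemidef.dotProduct_mulVec_nonneg a
    have hb := hD.posSemidef.dotProduct_mulVec_nonneg b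
    simp only [star_trivial] at ha hb
    have hab : a ≠ 0 ∨ b ≠ 0 := by
      by_contra! hcon
      apply hx
      rw [hcon.1, hcon.2]
      ext (i | i) <;> rfl
    have key : star (Sum.elim a b) ⬝ᵥ fromBlocks B 0 0 D *ᵥ Sum.elim a b =
        a ⬝ᵥ B *ᵥ a + b ⬝ᵥ D *ᵥ b := by
      simp [fromBlocks_mulVec]
    rw [key]
    rcases hab with h0 | h0
    · exact add_pos_of_pos_of_nonneg (by simpa using hB.dotProduct_mulVec_pos h0) hb
    · exact add_pos_of_nonneg_of_pos ha (by simpa using hD.dotProduct_mulVec_pos h0)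

theorem posDef_iff_mulVec {n : ℕ} {Q M : Matrix (Fin n) (Fin n) ℝ} (hQ : Q.PosDef) (hM : Mᵀ = M) :
    M.PosDef ↔ ∀ x ≠ 0, 0 < (Q *ᵥ x) ⬝ᵥ M *ᵥ Q *ᵥ x := by
  have hinj := Matrix.mulVec_injective_iff_isUnit.mpr hQ.isUnit
  constructor
  · intro h x hx
    have : Q *ᵥ x ≠ 0 := fun h0 => hx (hinj (by simpa using h0))
    simpa using h.dotProduct_mulVec_pos this
  · intro h
    refine .of_dotProduct_mulVec_pos (by simpa [IsHermitian] using hM) fun u hu => ?_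
    obtain ⟨x, rfl⟩ := Matrix.mulVec_surjective_iff_isUnit.mpr hQ.isUnit u
    rw [star_trivial]
    exact h x fun h0 => hu (by simp [h0])

/-- For `A = (J - R) * Q`, definiteness of the two blocks says that the symmetric part of `Q * A`
lies strictly between `h • Q` and `k • Q`. -/
theorem posDef_blocks_iff {n : ℕ} {h k : ℝ} {J R Q : Matrix (Fin n) (Fin n) ℝ}
    (hJ : Jᵀ = -J) (hR : Rᵀ = R) (hQ : Q.PosDef) :
    (fromBlocks (k • Q⁻¹ + R) 0 0 ((-h) • Q⁻¹ - R)).PosDef ↔ ∀ x ≠ 0,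
      h * (x ⬝ᵥ Q *ᵥ x) < x ⬝ᵥ Q *ᵥ ((J - R) * Q) *ᵥ x ∧
      x ⬝ᵥ Q *ᵥ ((J - R) * Q) *ᵥ x < k * (x ⬝ᵥ Q *ᵥ x) := by
  have hT : Qᵀ = Q := by simpa using hQ.isHermitian.eq
  have hJ0 (u : Fin n → ℝ) : u ⬝ᵥ J *ᵥ u = 0 := by
    have : u ⬝ᵥ J *ᵥ u = -(u ⬝ᵥ J *ᵥ u) := by
      conv_lhs => rw [dotProduct_mulVec, ← mulVec_transpose, hJ, dotProduct_comm]
      simp [neg_mulVec]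
    linarith
  have hA (x : Fin n → ℝ) :
      x ⬝ᵥ Q *ᵥ ((J - R) * Q) *ᵥ x = -((Q *ᵥ x) ⬝ᵥ R *ᵥ Q *ᵥ x) := by
    rw [dotProduct_mulVec, ← mulVec_transpose, hT, ← mulVec_mulVec, sub_mulVec, dotProduct_sub,
      hJ0, zero_sub]
  have hinv (x : Fin n → ℝ) : (Q *ᵥ x) ⬝ᵥ Q⁻¹ *ᵥ Q *ᵥ x = x ⬝ᵥ Q *ᵥ x := by
    rw [mulVec_mulVec, nonsing_inv_mul _ ((isUnit_iff_isUnit_det _).mp hQ.isUnit), one_mulVec,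
      dotProduct_comm]
  rw [posDef_fromBlocks_zero_iff,
    posDef_iff_mulVec hQ (by simp [transpose_nonsing_inv, hT, hR]),
    posDef_iff_mulVec hQ (by simp [transpose_nonsing_inv, hT, hR]), ← forall₂_and]
  refine forall₂_congr fun x _ => ?_
  rw [hA, add_mulVec, sub_mulVec, smul_mulVec, smul_mulVec, dotProduct_add, dotProduct_sub,
    dotProduct_smul, dotProduct_smul, hinv, smul_eq_mul, smul_eq_mul]
  constructor <;> rintro ⟨h1, h2⟩ <;> constructor <;> linarith

/-- DH characterization of matrices with all eigenvalues in the vertical strip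
`{z : h < Re z < k}`. -/
theorem vertical_strip_stable_iff_DH {n : ℕ} (h k : ℝ) (hhk : h < k)
    (A : Matrix (Fin n) (Fin n) ℝ) :
    (∀ z : ℂ, ((A.map Complex.ofReal).charpoly).IsRoot z → h < z.re ∧ z.re < k)
    ↔ ∃ J R Q : Matrix (Fin n) (Fin n) ℝ, Jᵀ = -J ∧ Rᵀ = R ∧ Q.PosDef ∧
        A = (J - R) * Q ∧
        (Matrix.fromBlocks (k • Q⁻¹ + R) 0 0 ((-h) • Q⁻¹ - R)).PosDef := by
  constructor
  · intro hA
    obtain ⟨Q, hQ, hAQ⟩ := exists_posDef_of_spectrum_in_strip hA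
    let B := A * Q⁻¹
    have hJ : ((1 / 2 : ℝ) • (B - Bᵀ))ᵀ = -((1 / 2 : ℝ) • (B - Bᵀ)) := by
      rw [transpose_smul, transpose_sub, transpose_transpose, ← smul_neg, neg_sub]
    have hR : ((-1 / 2 : ℝ) • (B + Bᵀ))ᵀ = (-1 / 2 : ℝ) • (B + Bᵀ) := by
      rw [transpose_smul, transpose_add, transpose_transpose, add_comm]
    have hB : (1 / 2 : ℝ) • (B - Bᵀ) - (-1 / 2 : ℝ) • (B + Bᵀ) = B := by module
    have hBQ : A = ((1 / 2 : ℝ) • (B - Bᵀ) - (-1 / 2 : ℝ) • (B + Bᵀ)) * Q := by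
      rw [hB, nonsing_inv_mul_cancel_right _ _ ((isUnit_iff_isUnit_det _).mp hQ.isUnit)]
    refine ⟨_, _, Q, hJ, hR, hQ, hBQ, ?_⟩
    rw [posDef_blocks_iff hJ hR hQ, ← hBQ]
    exact hAQ
  · rintro ⟨J, R, Q, hJ, hR, hQ, rfl, hM⟩
    exact spectrum_in_strip_of_posDef hQ ((posDef_blocks_iff hJ hR hQ).mp hM)
end

section
/- Let k ∈ ℝ, and let Ω be the left halfplane Ω = {z ∈ ℂ : Re(z) < k}. A real n×n matrix A has all of its complex eigenvalues in Ω if and only if A = (J − R)Q for some real n×n matrices J, R, Q with Jᵀ = −J, Rᵀ = R, Q symmetric positive definite, and such that kQ⁻¹ + R is positive definite. -/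
open Matrix

open Filter Topology in
theorem tendsto_pow_zero_of_spectralRadius_lt_one {A : Type*} [NormedRing A]
    [NormedAlgebra ℂ A] [CompleteSpace A] {a : A} (ha : spectralRadius ℂ a < 1) :
    Tendsto (fun m : ℕ => a ^ m) atTop (𝓝 0) := by
  obtain ⟨r, har, hr⟩ := ENNReal.lt_iff_exists_nnreal_btwn.mp ha
  have hr1 : r < 1 := by exact_mod_cast hr
  have hbound : ∀ᶠ m : ℕ in atTop, ‖a ^ m‖ ≤ (r : ℝ) ^ m := by
    filter_upwards [(spectrum.pow_nnnorm_pow_one_div_tendsto_nhds_spectralRadius a).eventually_lt_const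
      har, eventually_gt_atTop 0] with m hm hm0
    have hm0' : (m : ℝ) ≠ 0 := by positivity
    have h := ENNReal.rpow_le_rpow hm.le (by positivity : (0 : ℝ) ≤ m)
    rw [← ENNReal.rpow_mul, one_div_mul_cancel hm0', ENNReal.rpow_one,
      ENNReal.rpow_natCast] at h
    exact_mod_cast h
  exact squeeze_zero_norm' hbound (tendsto_pow_atTop_nhds_zero_of_lt_one r.2 hr1)

section L2

open scoped Matrix.Norms.L2Operator

theorem Matrix.posDef_one_sub_mul_transpose {ι : Type*} [Fintype ι] [DecidableEq ι]
    {E : Matrix ι ι ℝ} (hE : ‖E‖ < 1) : (1 - E * Eᵀ).PosDef := by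
  refine PosDef.of_dotProduct_mulVec_pos ?_ fun {x} hx => ?_
  · simp [IsHermitian, conjTranspose_eq_transpose_of_trivial]
  · have hx' : 0 < ‖WithLp.toLp 2 x‖ := by simpa using hx
    have hle : ‖WithLp.toLp 2 (Eᵀ *ᵥ x)‖ ≤ ‖E‖ * ‖WithLp.toLp 2 x‖ := by
      rw [← l2_opNorm_conjTranspose E, conjTranspose_eq_transpose_of_trivial]
      exact l2_opNorm_mulVec Eᵀ (WithLp.toLp 2 x)
    have hlt : ‖WithLp.toLp 2 (Eᵀ *ᵥ x)‖ ^ 2 < ‖WithLp.toLp 2 x‖ ^ 2 := by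
      gcongr
      nlinarith
    have hsq (y : ι → ℝ) : ‖WithLp.toLp 2 y‖ ^ 2 = y ⬝ᵥ y := by
      rw [EuclideanSpace.norm_sq_eq]
      simp [dotProduct, sq]
    rw [hsq, hsq] at hlt
    have hE' : x ⬝ᵥ (E * Eᵀ) *ᵥ x = (Eᵀ *ᵥ x) ⬝ᵥ (Eᵀ *ᵥ x) := by
      rw [← mulVec_mulVec, dotProduct_mulVec, mulVec_transpose]
    rw [star_trivial, sub_mulVec, one_mulVec, dotProduct_sub, hE']
    linarith

open Filter Topology in
theorem Matrix.eventually_norm_pow_lt_one {ι : Type*} [Fintype ι] [DecidableEq ι]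
    {D : Matrix ι ι ℝ} (hD : ∀ z ∈ spectrum ℂ (D.map Complex.ofReal), ‖z‖ < 1) :
    ∀ᶠ m : ℕ in atTop, ‖D ^ m‖ < 1 := by
  cases isEmpty_or_nonempty ι
  · simp [Subsingleton.elim (_ : Matrix ι ι ℝ) 0]
  have hrad : spectralRadius ℂ (D.map Complex.ofReal) < 1 := by
    simpa using spectrum.spectralRadius_lt_of_forall_lt (D.map Complex.ofReal) (r := 1)
      fun z hz => hD z hz
  have htend := tendsto_pow_zero_of_spectralRadius_lt_one hrad
  have hre : Tendsto (fun m : ℕ => D ^ m) atTop (𝓝 0) := by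
    have hcont : Continuous fun M : Matrix ι ι ℂ => M.map Complex.re :=
      continuous_id.matrix_map Complex.continuous_re
    have h := (hcont.tendsto 0).comp htend
    convert! h using 2 with m
    have hpow : (D.map Complex.ofReal) ^ m = (D ^ m).map Complex.ofReal :=
      (map_pow Complex.ofRealHom.mapMatrix D m).symm
    ext i j
    simp [hpow]
  simpa using hre.norm.eventually_lt_const (by simp : ‖(0 : Matrix ι ι ℝ)‖ < 1)

/-- A real matrix whose complex eigenvalues all lie in the open unit disc admits a positive
definite solution of the strict Stein inequality. -/
theorem Matrix.exists_posDef_stein {ι : Type*} [Fintype ι] [DecidableEq ι]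
    {D : Matrix ι ι ℝ} (hD : ∀ z ∈ spectrum ℂ (D.map Complex.ofReal), ‖z‖ < 1) :
    ∃ X : Matrix ι ι ℝ, X.PosDef ∧ (X - D * X * Dᵀ).PosDef := by
  obtain ⟨m, hm⟩ := Filter.eventually_atTop.mp (eventually_norm_pow_lt_one hD)
  refine ⟨∑ i ∈ Finset.range (m + 1), D ^ i * (D ^ i)ᵀ, ?_, ?_⟩
  · rw [Finset.sum_range_succ']
    refine PosDef.posSemidef_add (posSemidef_sum _ fun i _ => ?_) (by simpa using PosDef.one)
    simpa [conjTranspose_eq_transpose_of_trivial] using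
      posSemidef_self_mul_conjTranspose (D ^ (i + 1))
  · convert posDef_one_sub_mul_transpose (hm (m + 1) m.le_succ) using 1
    have hshift : D * (∑ i ∈ Finset.range (m + 1), D ^ i * (D ^ i)ᵀ) * Dᵀ =
        ∑ i ∈ Finset.range (m + 1), D ^ (i + 1) * (D ^ (i + 1))ᵀ := by
      simp only [Finset.mul_sum, Finset.sum_mul, pow_succ' D, transpose_mul, mul_assoc]
    rw [hshift, ← Finset.sum_sub_distrib, Finset.sum_range_sub']
    simp

end L2

open Filter Topology in
theorem Complex.eventually_norm_one_add_mul_lt_one {z : ℂ} (hz : z.re < 0) :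
    ∀ᶠ ε : ℝ in 𝓝[>] 0, ‖1 + ε * z‖ < 1 := by
  have hcont : Tendsto (fun ε : ℝ => 2 * z.re + ε * Complex.normSq z) (𝓝[>] 0)
      (𝓝 (2 * z.re + 0 * Complex.normSq z)) :=
    (Continuous.tendsto (by fun_prop) 0).mono_left nhdsWithin_le_nhds
  filter_upwards [hcont.eventually_lt_const (u := 0) (by linarith), self_mem_nhdsWithin]
    with ε hε hpos
  have hsq : ‖1 + ε * z‖ ^ 2 = 1 + ε * (2 * z.re + ε * Complex.normSq z) := by
    rw [← Complex.normSq_eq_norm_sq, Complex.normSq_apply, Complex.normSq_apply]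
    simp
    ring
  have hneg := mul_neg_of_pos_of_neg (Set.mem_Ioi.mp hpos) hε
  exact (sq_lt_one_iff₀ (norm_nonneg _)).mp (by linarith)

open Filter Topology in
/-- **Lyapunov's theorem**: a Hurwitz matrix admits a positive definite solution of the strict
Lyapunov inequality. -/
theorem Matrix.exists_posDef_lyapunov {ι : Type*} [Fintype ι] [DecidableEq ι]
    {B : Matrix ι ι ℝ} (hB : ∀ z ∈ spectrum ℂ (B.map Complex.ofReal), z.re < 0) :
    ∃ X : Matrix ι ι ℝ, X.PosDef ∧ (-(B * X + X * Bᵀ)).PosDef := by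
  obtain ⟨ε, hε, hpos⟩ : ∃ ε : ℝ,
      (∀ z ∈ spectrum ℂ (B.map Complex.ofReal), ‖1 + ε * z‖ < 1) ∧ 0 < ε := by
    have hev : ∀ᶠ ε : ℝ in 𝓝[>] 0,
        ∀ z ∈ spectrum ℂ (B.map Complex.ofReal), ‖1 + ε * z‖ < 1 :=
      (finite_spectrum (B.map Complex.ofReal)).eventually_all.mpr
        fun z hz => Complex.eventually_norm_one_add_mul_lt_one (hB z hz)
    exact (hev.and self_mem_nhdsWithin).exists
  have hstep : ∀ z ∈ spectrum ℂ ((1 + ε • B).map Complex.ofReal), ‖z‖ < 1 := by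
    intro w hw
    have hε0 : (ε : ℂ) ≠ 0 := by exact_mod_cast hpos.ne'
    have hmap : (1 + ε • B).map Complex.ofReal =
        algebraMap ℂ _ 1 + Units.mk0 (ε : ℂ) hε0 • B.map Complex.ofReal := by
      ext i j
      by_cases hij : i = j <;> simp [hij, Units.smul_def]
    rw [hmap, ← spectrum.singleton_add_eq, spectrum.unit_smul_eq_smul] at hw
    obtain ⟨_, rfl, _, ⟨z, hz, rfl⟩, rfl⟩ := hw
    exact hε z hz
  obtain ⟨X, hX, hstein⟩ := exists_posDef_stein hstep
  refine ⟨X, hX, ?_⟩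
  have hBXB : (ε • (B * X * Bᵀ)).PosSemidef := by
    refine PosSemidef.smul ?_ hpos.le
    simpa [conjTranspose_eq_transpose_of_trivial] using
      hX.posSemidef.mul_mul_conjTranspose_same B
  convert (hstein.smul (inv_pos.mpr hpos)).add_posSemidef hBXB using 1
  have hexpand : X - (1 + ε • B) * X * (1 + ε • B)ᵀ =
      ε • (-(B * X + X * Bᵀ) - ε • (B * X * Bᵀ)) := by
    simp only [transpose_add, transpose_one, transpose_smul, add_mul, mul_add, one_mul, mul_one,
      smul_mul_assoc, mul_smul_comm, smul_sub, smul_neg, smul_add]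
    abel
  rw [hexpand, inv_smul_smul₀ hpos.ne', sub_add_cancel]

/-- A real matrix with complex eigenvalue `z` has a left eigenvector, given here by its real and
imaginary parts. -/
theorem Matrix.exists_re_im_left_eigenvector {ι : Type*} [Fintype ι] [DecidableEq ι]
    {A : Matrix ι ι ℝ} {z : ℂ} (hz : ((A.map Complex.ofReal).charpoly).IsRoot z) :
    ∃ a b : ι → ℝ, (a ≠ 0 ∨ b ≠ 0) ∧ a ᵥ* A = z.re • a - z.im • b ∧
      b ᵥ* A = z.re • b + z.im • a := by
  rw [Polynomial.IsRoot, eval_charpoly] at hz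
  obtain ⟨v, hv, hvA⟩ := exists_vecMul_eq_zero_iff.mpr hz
  have heig : v ᵥ* A.map Complex.ofReal = z • v := by
    rw [vecMul_sub, sub_eq_zero] at hvA
    rw [← hvA, scalar_apply]
    ext i
    simp [vecMul_diagonal, mul_comm]
  refine ⟨fun i => (v i).re, fun i => (v i).im, ?_, ?_, ?_⟩
  · by_contra! h
    exact hv (funext fun i => Complex.ext (congrFun h.1 i) (congrFun h.2 i))
  · ext j
    simpa [vecMul, dotProduct] using congrArg Complex.re (congrFun heig j)
  · ext j
    simpa [vecMul, dotProduct] using congrArg Complex.im (congrFun heig j)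

theorem Matrix.dotProduct_mulVec_self_of_transpose_eq_neg {ι : Type*} [Fintype ι]
    {J : Matrix ι ι ℝ} (hJ : Jᵀ = -J) (x : ι → ℝ) : x ⬝ᵥ J *ᵥ x = 0 := by
  have h : x ⬝ᵥ J *ᵥ x = x ⬝ᵥ Jᵀ *ᵥ x := by
    rw [mulVec_transpose, dotProduct_mulVec, dotProduct_comm]
  rw [hJ, neg_mulVec, dotProduct_neg] at h
  linarith

/-- DH characterization of matrices with all eigenvalues in the left halfplane
`{z : Re z < k}`. -/
theorem left_halfplane_stable_iff_DH {n : ℕ} (k : ℝ)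
    (A : Matrix (Fin n) (Fin n) ℝ) :
    (∀ z : ℂ, ((A.map Complex.ofReal).charpoly).IsRoot z → z.re < k)
    ↔ ∃ J R Q : Matrix (Fin n) (Fin n) ℝ, Jᵀ = -J ∧ Rᵀ = R ∧ Q.PosDef ∧
        A = (J - R) * Q ∧ (k • Q⁻¹ + R).PosDef := by
  constructor
  · intro h
    have hshift : ∀ z ∈ spectrum ℂ ((A - k • 1).map Complex.ofReal), z.re < 0 := by
      intro w hw
      have hmap : (A - k • 1).map Complex.ofReal =
          algebraMap ℂ _ (-k : ℂ) + A.map Complex.ofReal := by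
        ext i j
        by_cases hij : i = j <;> simp [hij, algebraMap_matrix_apply, sub_eq_neg_add]
      rw [hmap, ← spectrum.singleton_add_eq] at hw
      obtain ⟨_, rfl, z, hz, rfl⟩ := hw
      have := h z (mem_spectrum_iff_isRoot_charpoly.mp hz)
      simpa using this
    obtain ⟨X, hX, hlyap⟩ := exists_posDef_lyapunov hshift
    have hXt : Xᵀ = X := by
      simpa [conjTranspose_eq_transpose_of_trivial] using hX.isHermitian.eq
    have hXdet : IsUnit X.det := (isUnit_iff_isUnit_det X).mp hX.isUnit
    refine ⟨(1 / 2 : ℝ) • (A * X - X * Aᵀ), -(1 / 2 : ℝ) • (A * X + X * Aᵀ), X⁻¹,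
      ?_, ?_, hX.inv, ?_, ?_⟩
    · simp [transpose_sub, transpose_mul, hXt, ← smul_neg]
    · simp [transpose_add, transpose_mul, hXt, add_comm]
    · have hAX : (1 / 2 : ℝ) • (A * X - X * Aᵀ) - -(1 / 2 : ℝ) • (A * X + X * Aᵀ) = A * X := by
        module
      rw [hAX, mul_nonsing_inv_cancel_right _ _ hXdet]
    · rw [nonsing_inv_nonsing_inv _ hXdet]
      convert hlyap.smul (by norm_num : (0 : ℝ) < 1 / 2) using 1
      simp only [sub_mul, mul_sub, transpose_sub, transpose_smul, transpose_one, smul_mul_assoc,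
        mul_smul_comm, one_mul, mul_one]
      module
  · rintro ⟨J, R, Q, hJ, -, hQ, rfl, hS⟩ z hz
    obtain ⟨a, b, hab, ha, hb⟩ := exists_re_im_left_eigenvector hz
    have hQdet : IsUnit Q.det := (isUnit_iff_isUnit_det Q).mp hQ.isUnit
    have hX := hQ.inv
    have hXt : (Q⁻¹)ᵀ = Q⁻¹ := by
      simpa [conjTranspose_eq_transpose_of_trivial] using hX.isHermitian.eq
    set X := Q⁻¹
    have hform (x : Fin n → ℝ) : (x ᵥ* ((J - R) * Q)) ⬝ᵥ X *ᵥ x = -(x ⬝ᵥ R *ᵥ x) := by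
      rw [← dotProduct_mulVec, mulVec_mulVec, mul_nonsing_inv_cancel_right _ _ hQdet, sub_mulVec,
        dotProduct_sub, dotProduct_mulVec_self_of_transpose_eq_neg hJ, zero_sub]
    have hsymm : b ⬝ᵥ X *ᵥ a = a ⬝ᵥ X *ᵥ b := by
      rw [dotProduct_mulVec, ← mulVec_transpose, hXt, dotProduct_comm]
    have hfa := hform a
    have hfb := hform b
    rw [ha, sub_dotProduct, smul_dotProduct, smul_dotProduct, smul_eq_mul, smul_eq_mul] at hfa
    rw [hb, add_dotProduct, smul_dotProduct, smul_dotProduct, smul_eq_mul, smul_eq_mul] at hfb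
    have hSum (x : Fin n → ℝ) :
        x ⬝ᵥ (k • X + R) *ᵥ x = k * (x ⬝ᵥ X *ᵥ x) + x ⬝ᵥ R *ᵥ x := by
      simp [add_mulVec, smul_mulVec, dotProduct_add]
    have hpos {M : Matrix (Fin n) (Fin n) ℝ} (hM : M.PosDef) :
        0 < a ⬝ᵥ M *ᵥ a + b ⬝ᵥ M *ᵥ b := by
      have ha0 := hM.posSemidef.dotProduct_mulVec_nonneg a
      have hb0 := hM.posSemidef.dotProduct_mulVec_nonneg b
      rcases hab with h | h
      · exact add_pos_of_pos_of_nonneg (hM.dotProduct_mulVec_pos h) hb0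
      · exact add_pos_of_nonneg_of_pos ha0 (hM.dotProduct_mulVec_pos h)
    have hSpos := hpos hS
    rw [hSum, hSum] at hSpos
    have hprod : 0 < (k - z.re) * (a ⬝ᵥ X *ᵥ a + b ⬝ᵥ X *ᵥ b) := by
      rw [hsymm] at hfa
      linarith
    exact sub_pos.mp (pos_of_mul_pos_left hprod (hpos hX).le)
end

section
/- Let q_e ∈ ℝ and a_e, b_e > 0, and let Ω be the open ellipse Ω = {x + iy ∈ ℂ : (x − q_e)²/a_e² + y²/b_e² < 1}. A real n×n matrix A has all of its complex eigenvalues in Ω if and only if A = (J − R)Q for some real n×n matrices J, R, Q with Jᵀ = −J, Rᵀ = R, Q symmetric positive definite, and such that the real symmetric 2n×2n block matrix [[a_e·Q⁻¹, q_e·Q⁻¹ − (a_e/b_e)·J + R], [q_e·Q⁻¹ + (a_e/b_e)·J + R, a_e·Q⁻¹]] is positive definite. -/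
open Matrix

theorem Module.End.exists_basis_repr_eq_zero_of_lt {K : Type*} [Field K] [IsAlgClosed K] {n : ℕ}
    {V : Type*} [AddCommGroup V] [Module K V] [FiniteDimensional K V]
    (hn : Module.finrank K V = n) (f : Module.End K V) :
    ∃ b : Module.Basis (Fin n) K V, ∀ i j, i < j → b.repr (f (b j)) i = 0 := by
  induction n generalizing V with
  | zero => exact ⟨Module.finBasisOfFinrankEq K V hn, fun i => i.elim0⟩
  | succ n ih =>
    have : Nontrivial V := Module.nontrivial_of_finrank_pos (R := K) (by omega)
    obtain ⟨c, hc⟩ := Module.End.exists_eigenvalue (K := K) (V := Module.Dual K V) f.dualMap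
    obtain ⟨φ, hφ⟩ := hc.exists_hasEigenvector
    have hfφ (v : V) : φ (f v) = c * φ v := by
      simpa using LinearMap.congr_fun hφ.apply_eq_smul v
    obtain ⟨y, hy⟩ : ∃ y, φ y = 1 := LinearMap.surjective hφ.2 1
    have hinv : ∀ v ∈ LinearMap.ker φ, f v ∈ LinearMap.ker φ := fun v hv => by
      rw [LinearMap.mem_ker] at hv ⊢
      rw [hfφ, hv, mul_zero]
    have hrank := Module.Dual.finrank_ker_add_one_of_ne_zero hφ.2
    obtain ⟨b, hb⟩ := ih (V := LinearMap.ker φ) (by omega) (f.restrict hinv)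
    have hli (a : K) (x : V) (hx : x ∈ LinearMap.ker φ) (h : a • y + x = 0) : a = 0 := by
      simpa [hy, LinearMap.mem_ker.mp hx] using congrArg φ h
    have hsp (z : V) : ∃ a : K, z + a • y ∈ LinearMap.ker φ := ⟨-φ z, by simp [hy]⟩
    let b' := Module.Basis.mkFinCons y b hli hsp
    have hb' (i : Fin n) : b' i.succ = b i := by simp [b']
    have h0 : b'.coord 0 ∘ₗ (LinearMap.ker φ).subtype = 0 := b.ext fun i => by
      simp [← hb']
    have hs (i : Fin n) : b'.coord i.succ ∘ₗ (LinearMap.ker φ).subtype = b.coord i :=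
      b.ext fun j => by simp [← hb', Finsupp.single_apply]
    refine ⟨b', fun i j hij => ?_⟩
    obtain ⟨j, rfl⟩ := Fin.exists_succ_eq.mpr (Fin.ne_zero_of_lt hij)
    rw [hb']
    induction i using Fin.cases with
    | zero => exact LinearMap.congr_fun h0 (f.restrict hinv (b j))
    | succ i =>
      exact (LinearMap.congr_fun (hs i) (f.restrict hinv (b j))).trans
        (hb i j (Fin.succ_lt_succ_iff.mp hij))

theorem Matrix.exists_mul_eq_mul_isLowerTriangular {K : Type*} [Field K] [IsAlgClosed K] {n : ℕ}
    (A : Matrix (Fin n) (Fin n) K) :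
    ∃ S T : Matrix (Fin n) (Fin n) K, IsUnit S ∧ A * S = S * T ∧ T.IsLowerTriangular := by
  obtain ⟨b, hb⟩ := Module.End.exists_basis_repr_eq_zero_of_lt
    (Module.finrank_fin_fun K (n := n)) (Matrix.toLin' A)
  have hA : A = LinearMap.toMatrix (Pi.basisFun K (Fin n)) (Pi.basisFun K (Fin n))
      (Matrix.toLin' A) := by
    rw [← LinearMap.toMatrix'_toLin' A]; simp
  refine ⟨(Pi.basisFun K (Fin n)).toMatrix b, LinearMap.toMatrix b b (Matrix.toLin' A), ?_, ?_,
    fun i j hij => ?_⟩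
  · exact IsUnit.of_mul_eq_one _ (Module.Basis.toMatrix_mul_toMatrix_flip _ b)
  · rw [basis_toMatrix_mul_linearMap_toMatrix]
    conv_lhs => rw [hA]
    rw [linearMap_toMatrix_mul_basis_toMatrix]
  · rw [LinearMap.toMatrix_apply]
    exact hb i j hij

open scoped ComplexOrder in
theorem Matrix.IsHermitian.posDef_of_sum_norm_lt {𝕜 n : Type*} [RCLike 𝕜] [Fintype n]
    [DecidableEq n] {M : Matrix n n 𝕜} (hM : M.IsHermitian)
    (h : ∀ k, ∑ j ∈ Finset.univ.erase k, ‖M k j‖ < RCLike.re (M k k)) : M.PosDef := by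
  refine hM.posDef_iff_eigenvalues_pos.mpr fun i => ?_
  have hev : Module.End.HasEigenvalue (Matrix.toLin' M) (hM.eigenvalues i : 𝕜) := by
    refine Module.End.hasEigenvalue_of_hasEigenvector (x := hM.eigenvectorBasis i) ⟨?_, ?_⟩
    · rw [Module.End.mem_eigenspace_iff, Matrix.toLin'_apply, hM.mulVec_eigenvectorBasis]
      ext j
      simp [RCLike.real_smul_eq_coe_mul]
    · simpa using hM.eigenvectorBasis.toBasis.ne_zero i
  obtain ⟨k, hk⟩ := eigenvalue_mem_ball hev
  rw [mem_closedBall_iff_norm] at hk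
  have := (RCLike.abs_re_le_norm _).trans hk
  rw [map_sub, RCLike.ofReal_re] at this
  linarith [h k, (abs_le.mp this).1]

open scoped ComplexOrder MatrixOrder in
theorem Matrix.PosDef.map_ofReal_s10 {n : Type*} [Fintype n] [DecidableEq n] {M : Matrix n n ℝ}
    (hM : M.PosDef) : (M.map Complex.ofReal).PosDef := by
  have hdet : (M.map Complex.ofReal).det = (M.det : ℂ) := (Complex.ofRealHom.map_det M).symm
  have hsemi : (M.map Complex.ofReal).PosSemidef := by
    obtain ⟨B, hB⟩ := CStarAlgebra.nonneg_iff_eq_star_mul_self.mp hM.posSemidef.nonneg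
    have : M.map Complex.ofReal = (B.map Complex.ofReal)ᴴ * B.map Complex.ofReal := by
      ext i j
      simp [hB, Matrix.mul_apply, Matrix.star_eq_conjTranspose]
    rw [this]
    exact Matrix.posSemidef_conjTranspose_mul_self _
  rw [hsemi.posDef_iff_det_ne_zero, hdet]
  exact_mod_cast hM.det_pos.ne'

open scoped ComplexOrder in
theorem Matrix.PosDef.map_re_s10 {n : Type*} [Fintype n] {M : Matrix n n ℂ}
    (hM : M.PosDef) : (M.map Complex.re).PosDef := by
  refine .of_dotProduct_mulVec_pos ?_ fun x hx => ?_
  · ext i j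
    simpa using congrArg Complex.re (hM.isHermitian.apply i j)
  · have hx' : Complex.ofReal ∘ x ≠ 0 := fun h => hx <| by
      ext i
      simpa using congrFun h i
    have := (Complex.lt_def.mp (hM.dotProduct_mulVec_pos hx')).1
    simpa [dotProduct, mulVec, Complex.mul_re] using this

/-- The Hermitian block matrix of the ellipse condition, written in terms of `P = Q⁻¹` and
`X = J - R`, where `s = (1 + a / b) / 2` and `t = (1 - a / b) / 2` for the ellipse with horizontal
radius `a`, vertical radius `b` and center `(q, 0)`. -/
def ellipseBlock {𝕜 n : Type*} [RCLike 𝕜] (a q s t : ℝ) (P X : Matrix n n 𝕜) :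
    Matrix (n ⊕ n) (n ⊕ n) 𝕜 :=
  fromBlocks (a • P) (q • P - s • X - t • Xᴴ) (q • P - t • X - s • Xᴴ) (a • P)

theorem ellipseBlock_conj {𝕜 n : Type*} [RCLike 𝕜] [Fintype n] (a q s t : ℝ)
    (S P X : Matrix n n 𝕜) :
    ellipseBlock a q s t (S * P * Sᴴ) (S * X * Sᴴ) =
      fromBlocks S 0 0 S * ellipseBlock a q s t P X * (fromBlocks S 0 0 S)ᴴ := by
  simp [ellipseBlock, fromBlocks_conjTranspose, fromBlocks_multiply, Matrix.mul_sub,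
    Matrix.sub_mul, Matrix.mul_assoc]

theorem ellipseBlock_isHermitian {𝕜 n : Type*} [RCLike 𝕜] (a q s t : ℝ)
    {P : Matrix n n 𝕜} (hP : P.IsHermitian) (X : Matrix n n 𝕜) :
    (ellipseBlock a q s t P X).IsHermitian := by
  have hr (r : ℝ) (M : Matrix n n 𝕜) : (r • M)ᴴ = r • Mᴴ := by
    rw [conjTranspose_smul, star_trivial]
  rw [Matrix.IsHermitian, ellipseBlock, fromBlocks_conjTranspose]
  simp only [conjTranspose_sub, hr, hP.eq, conjTranspose_conjTranspose]
  congr 1 <;> abel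

theorem ellipseBlock_map_re {n : Type*} (a q s t : ℝ) (P X : Matrix n n ℂ) :
    (ellipseBlock a q s t P X).map Complex.re =
      ellipseBlock a q s t (P.map Complex.re) (X.map Complex.re) := by
  ext (i | i) (j | j) <;> simp [ellipseBlock]

theorem ellipseBlock_map_ofReal {n : Type*} (a q s t : ℝ) (P X : Matrix n n ℝ) :
    (ellipseBlock a q s t P X).map Complex.ofReal =
      ellipseBlock a q s t (P.map Complex.ofReal) (X.map Complex.ofReal) := by
  ext (i | i) (j | j) <;> simp [ellipseBlock]

theorem ellipseBlock_sub {n : Type*} (a q c : ℝ) (P : Matrix n n ℝ) {J R : Matrix n n ℝ}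
    (hJ : Jᵀ = -J) (hR : Rᵀ = R) :
    ellipseBlock a q ((1 + c) / 2) ((1 - c) / 2) P (J - R) =
      fromBlocks (a • P) (q • P - c • J + R) (q • P + c • J + R) (a • P) := by
  rw [ellipseBlock, conjTranspose_eq_transpose_of_trivial, transpose_sub, hJ, hR]
  congr 1 <;> module

theorem ellipse_normSq_lt_iff {a b q : ℝ} (ha : 0 < a) (hb : 0 < b) (z : ℂ) :
    Complex.normSq (q - ((1 + a / b) / 2 : ℝ) * z - ((1 - a / b) / 2 : ℝ) * star z) < a ^ 2 ↔
      (z.re - q) ^ 2 / a ^ 2 + z.im ^ 2 / b ^ 2 < 1 := by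
  have : Complex.normSq (q - ((1 + a / b) / 2 : ℝ) * z - ((1 - a / b) / 2 : ℝ) * star z) =
      a ^ 2 * ((z.re - q) ^ 2 / a ^ 2 + z.im ^ 2 / b ^ 2) := by
    simp only [Complex.normSq_apply, Complex.sub_re, Complex.sub_im, Complex.mul_re,
      Complex.mul_im, Complex.ofReal_re, Complex.ofReal_im, Complex.star_def, Complex.conj_re,
      Complex.conj_im]
    field_simp
    ring
  rw [this, mul_lt_iff_lt_one_right (by positivity)]

/-- Rescaling the basis of a lower triangular matrix makes its off-diagonal part arbitrarily
small, so that any strict open condition on the diagonal carries over. -/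
theorem Matrix.IsLowerTriangular.exists_isUnit_mul_eq_mul {n : ℕ}
    {T : Matrix (Fin n) (Fin n) ℂ} (hT : T.IsLowerTriangular)
    {U : Set (Matrix (Fin n) (Fin n) ℂ)} (hU : IsOpen U) (hTU : diagonal T.diag ∈ U) :
    ∃ D C : Matrix (Fin n) (Fin n) ℂ, IsUnit D ∧ T * D = D * C ∧ C ∈ U := by
  let C (ε : ℝ) : Matrix (Fin n) (Fin n) ℂ := of fun i j => T i j * (ε : ℂ) ^ (i - j : ℕ)
  have hC : Continuous C := by
    refine continuous_matrix fun i j => ?_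
    simp only [C, of_apply]
    fun_prop
  have hC0 : C 0 = diagonal T.diag := by
    ext i j
    rcases lt_trichotomy i j with h | rfl | h
    · simp [C, h.ne, show T i j = 0 from hT h]
    · simp [C]
    · simp [C, h.ne', Nat.sub_ne_zero_of_lt h]
  have hev : ∀ᶠ ε in nhdsWithin (0 : ℝ) (Set.Ioi 0), C ε ∈ U :=
    (hC.tendsto 0).mono_left nhdsWithin_le_nhds (hU.mem_nhds (hC0 ▸ hTU))
  obtain ⟨ε, hεU, hε⟩ := (hev.and self_mem_nhdsWithin).exists
  have hε0 : (ε : ℂ) ≠ 0 := Complex.ofReal_ne_zero.mpr (ne_of_gt hε)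
  refine ⟨diagonal fun i => (ε : ℂ)⁻¹ ^ (i : ℕ), C ε, ?_, ?_, hεU⟩
  · rw [isUnit_diagonal, Pi.isUnit_iff]
    exact fun i => (pow_ne_zero _ (inv_ne_zero hε0)).isUnit
  · ext i j
    rw [mul_diagonal, diagonal_mul]
    rcases lt_or_ge i j with h | h
    · simp [C, show T i j = 0 from hT h]
    · have : (ε : ℂ) ^ (i : ℕ) = ε ^ (i - j : ℕ) * ε ^ (j : ℕ) := by
        rw [← pow_add, Nat.sub_add_cancel h]
      simp only [C, of_apply, inv_pow, this]
      field_simp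

open scoped ComplexOrder in
theorem exists_ellipseBlock_posDef {n : ℕ} {a b q : ℝ} (ha : 0 < a) (hb : 0 < b)
    {A : Matrix (Fin n) (Fin n) ℂ} (hA : ∀ z, A.charpoly.IsRoot z →
      (z.re - q) ^ 2 / a ^ 2 + z.im ^ 2 / b ^ 2 < 1) :
    ∃ P : Matrix (Fin n) (Fin n) ℂ, P.PosDef ∧
      (ellipseBlock a q ((1 + a / b) / 2) ((1 - a / b) / 2) P (A * P)).PosDef := by
  set s := (1 + a / b) / 2
  set t := (1 - a / b) / 2
  obtain ⟨S, T, hS, hAS, hT⟩ := A.exists_mul_eq_mul_isLowerTriangular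
  have hroot (i : Fin n) : A.charpoly.IsRoot (T i i) := by
    obtain ⟨S, rfl⟩ := hS
    have hAT : A = S * T * (S : Matrix (Fin n) (Fin n) ℂ)⁻¹ := by
      rw [← hAS, mul_assoc, ← coe_units_inv, S.mul_inv, mul_one]
    have hT' : Tᵀ.IsUpperTriangular := fun i j hij => hT hij
    rw [hAT, charpoly_units_conj, ← charpoly_transpose,
      charpoly_of_isUpperTriangular _ hT', Polynomial.IsRoot, Polynomial.eval_prod]
    exact Finset.prod_eq_zero (Finset.mem_univ i) (by simp)
  let U : Set (Matrix (Fin n) (Fin n) ℂ) := {C | ∀ k, ∑ j ∈ Finset.univ.erase k,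
    ‖ellipseBlock a q s t 1 C k j‖ < RCLike.re (ellipseBlock a q s t 1 C k k)}
  have hcont (k l) : Continuous fun C : Matrix (Fin n) (Fin n) ℂ =>
      ellipseBlock a q s t 1 C k l := by
    unfold ellipseBlock
    fun_prop
  have hU : IsOpen U := by
    simp only [U, Set.ofPred_forall]
    exact isOpen_iInter_of_finite fun k => isOpen_lt (by fun_prop) (by fun_prop)
  have hTU : diagonal T.diag ∈ U := by
    have hnorm (i : Fin n) : ‖(q : ℂ) - s * T i i - t * star (T i i)‖ < a := by
      refine lt_of_pow_lt_pow_left₀ 2 ha.le ?_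
      rw [← Complex.normSq_eq_norm_sq]
      exact (ellipse_normSq_lt_iff ha hb _).mpr (hA _ (hroot i))
    have hnorm' (i : Fin n) : ‖(q : ℂ) - t * T i i - s * star (T i i)‖ < a := by
      have : (q : ℂ) - t * T i i - s * star (T i i) = star (q - s * T i i - t * star (T i i)) := by
        simp only [star_sub, star_mul', Complex.star_def, Complex.conj_ofReal,
          Complex.conj_conj]
        ring
      rw [this, norm_star]
      exact hnorm i
    rintro (i | i)
    · rw [Finset.sum_eq_single (Sum.inr i)]
      · simpa [ellipseBlock] using hnorm i
      · rintro (j | j) hj hj'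
        · simp_all [ellipseBlock, Matrix.one_apply, eq_comm]
        · simp_all [ellipseBlock, Matrix.one_apply, eq_comm]
      · simp
    · rw [Finset.sum_eq_single (Sum.inl i)]
      · simpa [ellipseBlock] using hnorm' i
      · rintro (j | j) hj hj'
        · simp_all [ellipseBlock, Matrix.one_apply, eq_comm]
        · simp_all [ellipseBlock, Matrix.one_apply, eq_comm]
      · simp
  obtain ⟨D, C, hD, hTD, hCU⟩ := hT.exists_isUnit_mul_eq_mul hU hTU
  have hSD : IsUnit (S * D) := hS.mul hD
  have hC : (ellipseBlock a q s t 1 C).PosDef :=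
    (ellipseBlock_isHermitian a q s t isHermitian_one C).posDef_of_sum_norm_lt hCU
  have hX : A * (S * D * 1 * (S * D)ᴴ) = S * D * C * (S * D)ᴴ := by
    rw [mul_one, ← mul_assoc, ← mul_assoc, hAS, mul_assoc S T, hTD, ← mul_assoc]
  refine ⟨S * D * 1 * (S * D)ᴴ, hSD.posDef_star_right_conjugate_iff.mpr .one, ?_⟩
  rw [hX, ellipseBlock_conj]
  refine IsUnit.posDef_star_right_conjugate_iff ?_ |>.mpr hC
  rw [isUnit_iff_isUnit_det, det_fromBlocks_zero₂₁]
  have := (isUnit_iff_isUnit_det _).mp hSD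
  exact this.mul this

open scoped ComplexOrder in
theorem ellipse_of_ellipseBlock_posDef {n : Type*} [Fintype n] [DecidableEq n] {a b q : ℝ}
    (ha : 0 < a) (hb : 0 < b) {A P : Matrix n n ℂ} (hP : P.PosDef)
    (h : (ellipseBlock a q ((1 + a / b) / 2) ((1 - a / b) / 2) P (A * P)).PosDef)
    {z : ℂ} (hz : A.charpoly.IsRoot z) :
    (z.re - q) ^ 2 / a ^ 2 + z.im ^ 2 / b ^ 2 < 1 := by
  rw [← ellipse_normSq_lt_iff ha hb]
  set s := (1 + a / b) / 2
  set t := (1 - a / b) / 2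
  set e : ℂ := q - s * z - t * star z with he
  obtain ⟨v, hv, hvA⟩ : ∃ v, v ≠ 0 ∧ v ᵥ* A = z • v := by
    rw [Polynomial.IsRoot, eval_charpoly] at hz
    obtain ⟨v, hv, hvA⟩ := exists_vecMul_eq_zero_iff.mpr hz
    refine ⟨v, hv, ?_⟩
    rw [vecMul_sub, sub_eq_zero] at hvA
    rw [← hvA]
    simp
  set w := star v with hw
  have hw0 : w ≠ 0 := star_ne_zero.mpr hv
  set p := star w ⬝ᵥ (P *ᵥ w) with hp
  have hp0 : 0 < p := hP.dotProduct_mulVec_pos hw0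
  have hX : star w ⬝ᵥ ((A * P) *ᵥ w) = z * p := by
    rw [← mulVec_mulVec, dotProduct_mulVec, hw, star_star, hvA, smul_dotProduct, smul_eq_mul,
      ← hw, hp, hw, star_star]
  have hstar (M : Matrix n n ℂ) : star w ⬝ᵥ (Mᴴ *ᵥ w) = star (star w ⬝ᵥ (M *ᵥ w)) := by
    rw [← star_dotProduct, star_mulVec, ← dotProduct_mulVec]
  have hpstar : star p = p := by
    rw [hp, ← hstar, hP.isHermitian.eq]
  have hXs : star w ⬝ᵥ ((A * P)ᴴ *ᵥ w) = star z * p := by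
    rw [hstar, hX, star_mul', hpstar]
  have hpos := h.dotProduct_mulVec_pos (x := Sum.elim (-e • w) ((a : ℂ) • w)) fun h0 => hw0 <| by
    simpa [ha.ne'] using congrArg (· ∘ Sum.inr) h0
  have key : star (Sum.elim (-e • w) ((a : ℂ) • w)) ⬝ᵥ
      (ellipseBlock a q s t P (A * P) *ᵥ Sum.elim (-e • w) ((a : ℂ) • w)) =
        (a * (a ^ 2 - Complex.normSq e) : ℝ) * p := by
    have hr (r : ℝ) (M : Matrix n n ℂ) : r • M = (r : ℂ) • M := rfl
    have hsum : star (Sum.elim (-e • w) ((a : ℂ) • w)) =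
        Sum.elim (star (-e) • star w) ((a : ℂ) • star w) := by
      ext (i | i) <;> simp
    rw [hsum, ellipseBlock, fromBlocks_mulVec, sumElim_dotProduct_sumElim]
    simp only [Sum.elim_comp_inl, Sum.elim_comp_inr, hr, sub_mulVec, smul_mulVec, mulVec_smul,
      dotProduct_add, dotProduct_sub, smul_dotProduct, dotProduct_smul, smul_eq_mul, hX, hXs, ← hp]
    push_cast
    rw [Complex.normSq_eq_conj_mul_self, ← Complex.star_def, he]
    simp only [star_sub, star_neg, star_mul', Complex.star_def, Complex.conj_ofReal,
      Complex.conj_conj]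
    ring
  have hpos' := (Complex.lt_def.mp (key ▸ hpos)).1
  rw [Complex.re_ofReal_mul] at hpos'
  have := pos_of_mul_pos_left hpos' (Complex.lt_def.mp hp0).1.le
  linarith [pos_of_mul_pos_right this ha.le]

/-- DH characterization of matrices with all eigenvalues in the open ellipse centered at
`(q_e, 0)` with horizontal radius `a_e` and vertical radius `b_e`. -/
theorem ellipse_stable_iff_DH {n : ℕ} (qe ae be : ℝ) (hae : 0 < ae) (hbe : 0 < be)
    (A : Matrix (Fin n) (Fin n) ℝ) :
    (∀ z : ℂ, ((A.map Complex.ofReal).charpoly).IsRoot z →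
      (z.re - qe) ^ 2 / ae ^ 2 + z.im ^ 2 / be ^ 2 < 1)
    ↔ ∃ J R Q : Matrix (Fin n) (Fin n) ℝ, Jᵀ = -J ∧ Rᵀ = R ∧ Q.PosDef ∧
        A = (J - R) * Q ∧
        (Matrix.fromBlocks
          (ae • Q⁻¹) (qe • Q⁻¹ - (ae / be) • J + R)
          (qe • Q⁻¹ + (ae / be) • J + R) (ae • Q⁻¹)).PosDef := by
  constructor
  · intro h
    obtain ⟨P, hP, hblock⟩ := exists_ellipseBlock_posDef hae hbe h
    have hP' := hP.map_re_s10
    have hPu := (isUnit_iff_isUnit_det _).mp hP'.isUnit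
    have hX : (A.map Complex.ofReal * P).map Complex.re = A * P.map Complex.re := by
      ext i j
      simp [mul_apply]
    have hblock' := hblock.map_re_s10
    rw [ellipseBlock_map_re, hX] at hblock'
    set X := A * P.map Complex.re with hXdef
    have hJR : (1 / 2 : ℝ) • (X - Xᵀ) - -(1 / 2 : ℝ) • (X + Xᵀ) = X := by module
    have hJ : ((1 / 2 : ℝ) • (X - Xᵀ))ᵀ = -((1 / 2 : ℝ) • (X - Xᵀ)) := by simp [← smul_neg]
    have hR : (-(1 / 2 : ℝ) • (X + Xᵀ))ᵀ = -(1 / 2 : ℝ) • (X + Xᵀ) := by simp [add_comm]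
    refine ⟨_, _, (P.map Complex.re)⁻¹, hJ, hR, hP'.inv, ?_, ?_⟩
    · rw [hJR, hXdef, mul_assoc, mul_nonsing_inv _ hPu, mul_one]
    · rwa [nonsing_inv_nonsing_inv _ hPu, ← ellipseBlock_sub _ _ _ _ hJ hR, hJR]
  · rintro ⟨J, R, Q, hJ, hR, hQ, rfl, hblock⟩ z hz
    have hX : ((J - R) * Q).map Complex.ofReal * Q⁻¹.map Complex.ofReal =
        (J - R).map Complex.ofReal := by
      have := Matrix.map_mul (f := Complex.ofRealHom) (L := (J - R) * Q) (M := Q⁻¹)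
      rw [mul_assoc, mul_nonsing_inv _ ((isUnit_iff_isUnit_det _).mp hQ.isUnit), mul_one] at this
      exact this.symm
    refine ellipse_of_ellipseBlock_posDef hae hbe hQ.inv.map_ofReal_s10 ?_ hz
    rw [hX, ← ellipseBlock_map_ofReal, ellipseBlock_sub _ _ _ _ hJ hR]
    exact hblock.map_ofReal_s10
end
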